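/- arXiv:2506.04644 — 2 statements merged into one kernel-verified Lean document; each statement's English description precedes it below -/
import Mathlib

section
/- Let γ₁, γ₂ : [0,1] → [0,T] be continuous, piecewise monotone functions with γ₁(0) = γ₂(0) = 0 and γ₁(1) = γ₂(1) = T. Then there exist continuous functions γ₁', γ₂' : [0,1] → [0,1] with γ₁'(0) = γ₂'(0) = 0, γ₁'(1) = γ₂'(1) = 1, and γ₁ ∘ γ₁' = γ₂ ∘ γ₂'. -/
/-- A function is piecewise monotone on `[0,1]` if there is a finite partition of
`[0,1]` into subintervals on each of which the function is monotone (nondecreasing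
or nonincreasing). -/
def PiecewiseMonotoneOn (g : ℝ → ℝ) : Prop :=
  ∃ (n : ℕ) (a : Fin (n + 1) → ℝ), Monotone a ∧ a 0 = 0 ∧ a (Fin.last n) = 1 ∧
    ∀ i : Fin n, MonotoneOn g (Set.Icc (a i.castSucc) (a i.succ)) ∨
      AntitoneOn g (Set.Icc (a i.castSucc) (a i.succ))

open Set Filter

namespace MountainClimbing

/-- The pairs of points of the box `[a, b] × [c, d]` at which `f` and `g` have equal height. -/
def equalHeight (f g : ℝ → ℝ) (a b c d : ℝ) : Set (ℝ × ℝ) :=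
  {p | p ∈ Icc a b ×ˢ Icc c d ∧ f p.1 = g p.2}

/-- The level set `F t = G u` of monotone unbounded functions contains a continuous curve,
increasing in both coordinates and parametrized by `t + u`. -/
theorem exists_monotone_curve {F G : ℝ → ℝ} (hF : Continuous F) (hG : Continuous G)
    (mF : Monotone F) (mG : Monotone G) (tF : Tendsto F atTop atTop) (bF : Tendsto F atBot atBot) :
    ∃ τ : ℝ → ℝ, Continuous τ ∧ Monotone τ ∧ Monotone (fun s => s - τ s) ∧
      (∀ s, F (τ s) = G (s - τ s)) ∧ ∀ s t, F t = G (s - t) → τ s ≤ t := by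
  have surj (s : ℝ) : Function.Surjective fun t => F t - G (s - t) := by
    refine Continuous.surjective (by fun_prop) ?_ ?_
    · refine tendsto_atTop_mono' _ ?_ (tendsto_atTop_add_const_right _ (-G s) tF)
      filter_upwards [eventually_ge_atTop 0] with t ht
      have := mG (show s - t ≤ s by linarith)
      linarith
    · refine tendsto_atBot_mono' _ ?_ (tendsto_atBot_add_const_right _ (-G s) bF)
      filter_upwards [eventually_le_atBot 0] with t ht
      have := mG (show s ≤ s - t by linarith)
      linarith
  have bdd (s : ℝ) : BddBelow {t | G (s - t) ≤ F t} := by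
    obtain ⟨t₀, ht₀⟩ := surj s (-1)
    refine ⟨t₀, fun t ht => ?_⟩
    by_contra! h
    have h₁ := mF h.le
    have h₂ := mG (show s - t₀ ≤ s - t by linarith)
    simp only [mem_ofPred_eq] at ht ht₀
    linarith
  let τ : ℝ → ℝ := fun s => sInf {t | G (s - t) ≤ F t}
  have τ_le {s t : ℝ} (h : G (s - t) ≤ F t) : τ s ≤ t := csInf_le (bdd s) h
  have τ_mem (s : ℝ) : G (s - τ s) ≤ F (τ s) := by
    refine IsClosed.csInf_mem (s := {t | G (s - t) ≤ F t})
      (isClosed_le (by fun_prop) hF) ?_ (bdd s)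
    obtain ⟨t, ht⟩ := surj s 0
    exact ⟨t, by simp only [mem_ofPred_eq] at ht ⊢; linarith⟩
  have mono : Monotone τ := fun s s' h =>
    τ_le ((mG (by linarith)).trans (τ_mem s'))
  have mono' : Monotone fun s => s - τ s := fun s s' h => by
    have : τ s' ≤ τ s + (s' - s) := τ_le <| by
      rw [show s' - (τ s + (s' - s)) = s - τ s by ring]
      exact (τ_mem s).trans (mF (by linarith))
    simp only
    linarith
  refine ⟨τ, ?_, mono, mono', fun s => ?_, fun s t h => τ_le h.ge⟩
  · refine (LipschitzWith.of_le_add fun s s' => ?_).continuous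
    rw [Real.dist_eq]
    rcases le_total s s' with h | h
    · linarith [mono h, abs_nonneg (s - s')]
    · have := mono' h
      simp only at this
      linarith [le_abs_self (s - s')]
  · obtain ⟨t, ht⟩ := surj s 0
    simp only at ht
    have h : τ s ≤ t := τ_le (by linarith)
    have h₁ := mF h
    have h₂ := mG (show s - t ≤ s - τ s by linarith)
    linarith [τ_mem s]

/-- A continuous monotone function on an interval extends to a continuous monotone function on
the line with slope one outside of the interval. -/
theorem exists_extension {f : ℝ → ℝ} {a b : ℝ} (hab : a ≤ b) (hf : ContinuousOn f (Icc a b))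
    (mf : MonotoneOn f (Icc a b)) :
    ∃ F : ℝ → ℝ, Continuous F ∧ Monotone F ∧ Tendsto F atTop atTop ∧ Tendsto F atBot atBot ∧
      EqOn F f (Icc a b) ∧ (∀ t < a, F t < f a) ∧ ∀ t > b, f b < F t := by
  have hc (t : ℝ) : max a (min b t) ∈ Icc a b := ⟨le_max_left _ _, max_le hab (min_le_left _ _)⟩
  have lo {t : ℝ} (h : t ≤ a) : max a (min b t) = a := by
    rw [min_eq_right (h.trans hab), max_eq_left h]
  have hi {t : ℝ} (h : b ≤ t) : max a (min b t) = b := by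
    rw [min_eq_left h, max_eq_right hab]
  refine ⟨fun t => f (max a (min b t)) + (t - max a (min b t)), ?_, ?_, ?_, ?_, ?_, ?_, ?_⟩
  · exact (hf.comp_continuous (by fun_prop) hc).add (by fun_prop)
  · intro t t' h
    have h₁ : f (max a (min b t)) ≤ f (max a (min b t')) :=
      mf (hc t) (hc t') (max_le_max_left _ (min_le_min_left _ h))
    have h₂ : t - max a (min b t) ≤ t' - max a (min b t') := by grind
    exact add_le_add h₁ h₂
  · refine tendsto_atTop_mono' _ ?_ (tendsto_atTop_add_const_right _ (f b - b) tendsto_id)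
    filter_upwards [eventually_ge_atTop b] with t ht
    simp only [hi ht, id]
    linarith
  · refine tendsto_atBot_mono' _ ?_ (tendsto_atBot_add_const_right _ (f a - a) tendsto_id)
    filter_upwards [eventually_le_atBot a] with t ht
    simp only [lo ht, id]
    linarith
  · intro t ht
    simp [ht.1, ht.2]
  · intro t ht
    simp only [lo ht.le]
    linarith
  · intro t ht
    simp only [hi (le_of_lt ht)]
    linarith

theorem joinedIn_equalHeight_of_monotoneOn {f g : ℝ → ℝ} {a b c d : ℝ}
    (hf : ContinuousOn f (Icc a b)) (hg : ContinuousOn g (Icc c d))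
    (mf : MonotoneOn f (Icc a b)) (mg : MonotoneOn g (Icc c d)) {p q : ℝ × ℝ}
    (hp : p ∈ equalHeight f g a b c d) (hq : q ∈ equalHeight f g a b c d) :
    JoinedIn (equalHeight f g a b c d) p q := by
  have hab : a ≤ b := hp.1.1.1.trans hp.1.1.2
  have hcd : c ≤ d := hp.1.2.1.trans hp.1.2.2
  obtain ⟨F, cF, mF, tF, bF, eF, loF, -⟩ := exists_extension hab hf mf
  obtain ⟨G, cG, mG, -, -, eG, -, hiG⟩ := exists_extension hcd hg mg
  obtain ⟨τ, cτ, mτ, mτ', eτ, τ_le⟩ := exists_monotone_curve cF cG mF mG tF bF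
  have mem_of {r : ℝ × ℝ} (h : r ∈ Icc a b ×ˢ Icc c d) (h' : F r.1 = G r.2) :
      r ∈ equalHeight f g a b c d := ⟨h, by rw [← eF h.1, ← eG h.2, h']⟩
  have key {r : ℝ × ℝ} (hr : r ∈ equalHeight f g a b c d) :
      (τ (r.1 + r.2), r.1 + r.2 - τ (r.1 + r.2)) ∈ Icc a b ×ˢ Icc c d ∧
      JoinedIn (equalHeight f g a b c d) r (τ (r.1 + r.2), r.1 + r.2 - τ (r.1 + r.2)) := by
    obtain ⟨⟨h₁, h₂⟩, h⟩ := hr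
    rw [← eF h₁, ← eG h₂] at h
    have hle : τ (r.1 + r.2) ≤ r.1 := τ_le _ _ (by rw [h]; congr 1; ring)
    have hτ := eτ (r.1 + r.2)
    set t := τ (r.1 + r.2)
    have hF := mF hle
    have hG := mG (show r.2 ≤ r.1 + r.2 - t by linarith)
    have ht : a ≤ t := by
      by_contra! hlt
      have := loF t hlt
      rw [← eF ⟨le_rfl, hab⟩] at this
      linarith [mF h₁.1]
    have hu : r.1 + r.2 - t ≤ d := by
      by_contra! hlt
      have := hiG _ hlt
      rw [← eG ⟨hcd, le_rfl⟩] at this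
      linarith [mG h₂.2]
    refine ⟨⟨⟨ht, hle.trans h₁.2⟩, by linarith [h₂.1], hu⟩, JoinedIn.of_segment_subset ?_⟩
    have hseg : segment ℝ r (t, r.1 + r.2 - t) ⊆ Icc (t, r.2) (r.1, r.1 + r.2 - t) :=
      (convex_Icc _ _).segment_subset ⟨⟨hle, le_rfl⟩, ⟨le_rfl, by simp only; linarith⟩⟩
        ⟨⟨le_rfl, by simp only; linarith⟩, ⟨hle, le_rfl⟩⟩
    intro z hz
    obtain ⟨⟨l₁, l₂⟩, u₁, u₂⟩ := hseg hz
    simp only at l₁ l₂ u₁ u₂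
    refine mem_of ⟨⟨ht.trans l₁, u₁.trans h₁.2⟩, h₂.1.trans l₂, u₂.trans hu⟩ ?_
    linarith [mF l₁, mF u₁, mG l₂, mG u₂]
  wlog hle : p.1 + p.2 ≤ q.1 + q.2 generalizing p q
  · exact (this hq hp (le_of_not_ge hle)).symm
  obtain ⟨⟨lp, -⟩, jp⟩ := key hp
  obtain ⟨⟨-, uq⟩, jq⟩ := key hq
  obtain ⟨⟨-, up⟩, -⟩ := key hp
  obtain ⟨⟨lq, -⟩, -⟩ := key hq
  refine jp.trans (JoinedIn.trans ?_ jq.symm)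
  have hcurve := ((JoinedIn.of_segment_subset (segment_eq_Icc hle).subset).map
    (f := fun s => (τ s, s - τ s)) (by fun_prop))
  refine hcurve.mono ?_
  rintro _ ⟨s, hs, rfl⟩
  exact mem_of ⟨⟨lp.1.trans (mτ hs.1), (mτ hs.2).trans lq.2⟩, up.1.trans (mτ' hs.1),
    (mτ' hs.2).trans uq.2⟩ (eτ s)

theorem monotoneOn_comp_neg {f : ℝ → ℝ} {a b : ℝ} (h : AntitoneOn f (Icc a b)) :
    MonotoneOn (fun x => f (-x)) (Icc (-b) (-a)) := fun x hx y hy hxy =>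
  h ⟨by linarith [hy.2], by linarith [hy.1]⟩ ⟨by linarith [hx.2], by linarith [hx.1]⟩
    (neg_le_neg hxy)

theorem continuousOn_comp_neg {f : ℝ → ℝ} {a b : ℝ} (h : ContinuousOn f (Icc a b)) :
    ContinuousOn (fun x => f (-x)) (Icc (-b) (-a)) :=
  h.comp continuousOn_neg fun x hx => ⟨by linarith [hx.2], by linarith [hx.1]⟩

theorem joinedIn_equalHeight {f g : ℝ → ℝ} {a b c d : ℝ}
    (hf : ContinuousOn f (Icc a b)) (hg : ContinuousOn g (Icc c d))
    (mf : MonotoneOn f (Icc a b) ∨ AntitoneOn f (Icc a b))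
    (mg : MonotoneOn g (Icc c d) ∨ AntitoneOn g (Icc c d)) {p q : ℝ × ℝ}
    (hp : p ∈ equalHeight f g a b c d) (hq : q ∈ equalHeight f g a b c d) :
    JoinedIn (equalHeight f g a b c d) p q := by
  wlog mf' : MonotoneOn f (Icc a b) generalizing f a b p q
  · have mf := monotoneOn_comp_neg (mf.resolve_left mf')
    have flip {r : ℝ × ℝ} (hr : r ∈ equalHeight f g a b c d) :
        (-r.1, r.2) ∈ equalHeight (fun x => f (-x)) g (-b) (-a) c d := by
      obtain ⟨⟨⟨h₁, h₂⟩, h₃⟩, h₄⟩ := hr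
      exact ⟨⟨⟨neg_le_neg h₂, neg_le_neg h₁⟩, h₃⟩, by simpa using h₄⟩
    have h := (this (continuousOn_comp_neg hf) (.inl mf) (flip hp) (flip hq) mf).map
      (f := fun r : ℝ × ℝ => (-r.1, r.2)) (by fun_prop)
    simp only [neg_neg] at h
    refine h.mono ?_
    rintro _ ⟨r, ⟨⟨⟨h₁, h₂⟩, h₃⟩, h₄⟩, rfl⟩
    exact ⟨⟨⟨le_neg_of_le_neg h₂, neg_le.mp h₁⟩, h₃⟩, h₄⟩
  wlog mg' : MonotoneOn g (Icc c d) generalizing g c d p q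
  · have mg := monotoneOn_comp_neg (mg.resolve_left mg')
    have flip {r : ℝ × ℝ} (hr : r ∈ equalHeight f g a b c d) :
        (r.1, -r.2) ∈ equalHeight f (fun x => g (-x)) a b (-d) (-c) := by
      obtain ⟨⟨h₃, ⟨h₁, h₂⟩⟩, h₄⟩ := hr
      exact ⟨⟨h₃, ⟨neg_le_neg h₂, neg_le_neg h₁⟩⟩, by simpa using h₄⟩
    have h := (this (continuousOn_comp_neg hg) (.inl mg) (flip hp) (flip hq) mg).map
      (f := fun r : ℝ × ℝ => (r.1, -r.2)) (by fun_prop)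
    simp only [neg_neg] at h
    refine h.mono ?_
    rintro _ ⟨r, ⟨⟨h₃, ⟨h₁, h₂⟩⟩, h₄⟩, rfl⟩
    exact ⟨⟨h₃, ⟨le_neg_of_le_neg h₂, neg_le.mp h₁⟩⟩, h₄⟩
  exact joinedIn_equalHeight_of_monotoneOn hf hg mf' mg' hp hq

theorem exists_nat_partition {g : ℝ → ℝ} (h : PiecewiseMonotoneOn g) :
    ∃ (n : ℕ) (a : ℕ → ℝ), Monotone a ∧ a 0 = 0 ∧ a (n + 1) = 1 ∧
      ∀ i < n + 1, MonotoneOn g (Icc (a i) (a (i + 1))) ∨ AntitoneOn g (Icc (a i) (a (i + 1))) := by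
  obtain ⟨n, a, ma, a0, a1, hg⟩ := h
  obtain _ | n := n
  · exact absurd (a0.symm.trans a1) zero_ne_one
  refine ⟨n, fun k => a ⟨min k (n + 1), by omega⟩, fun i j hij => ma ?_, ?_, ?_, fun i hi => ?_⟩
  · simp only [Fin.mk_le_mk]
    omega
  · simpa using a0
  · simpa [Fin.last] using a1
  · have e₁ : (⟨min i (n + 1), by omega⟩ : Fin (n + 1 + 1)) = Fin.castSucc ⟨i, hi⟩ :=
      Fin.ext (by simp; omega)
    have e₂ : (⟨min (i + 1) (n + 1), by omega⟩ : Fin (n + 1 + 1)) = Fin.succ ⟨i, hi⟩ :=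
      Fin.ext (by simp; omega)
    simp only [e₁, e₂]
    exact hg ⟨i, hi⟩

theorem sum_range_add_succ (v : ℕ → ZMod 2) (n : ℕ) :
    ∑ i ∈ Finset.range n, (v i + v (i + 1)) = v 0 + v n := by
  induction n with
  | zero => simp [CharTwo.add_self_eq_zero]
  | succ n ih =>
    rw [Finset.sum_range_succ, ih, add_assoc, ← add_assoc (v n), CharTwo.add_self_eq_zero, zero_add]

/-- A mod 2 edge labelling of a grid that sums to zero around every cell sums to zero along the
boundary of the grid. -/
theorem boundary_sum_eq_zero {n m : ℕ} {V H : ℕ → ℕ → ZMod 2}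
    (h : ∀ i < n, ∀ j < m, (V i j + V (i + 1) j) + (H i j + H i (j + 1)) = 0) :
    ∑ j ∈ Finset.range m, (V 0 j + V n j) + ∑ i ∈ Finset.range n, (H i 0 + H i m) = 0 := by
  calc
    _ = ∑ j ∈ Finset.range m, ∑ i ∈ Finset.range n, (V i j + V (i + 1) j) +
        ∑ i ∈ Finset.range n, ∑ j ∈ Finset.range m, (H i j + H i (j + 1)) := by
      simp only [sum_range_add_succ, sum_range_add_succ (fun i => V i _)]
    _ = ∑ i ∈ Finset.range n, ∑ j ∈ Finset.range m,
        ((V i j + V (i + 1) j) + (H i j + H i (j + 1))) := by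
      rw [Finset.sum_comm, ← Finset.sum_add_distrib]
      simp only [Finset.sum_add_distrib]
    _ = 0 := Finset.sum_eq_zero fun i hi => Finset.sum_eq_zero fun j hj =>
      h i (Finset.mem_range.1 hi) j (Finset.mem_range.1 hj)

open Classical in
/-- In a two-coloured grid whose boundary is coloured `False` exactly on the left and top sides
(apart from the ends `(0, 0)` and `(n + 1, m + 1)`), two-coloured edges are linked across cells
from the bottom left corner to the top right corner. Here `RV i j` and `RH i j` say that
the vertical, respectively horizontal, edge starting at `(i, j)` is reached. -/
theorem reach_last_edge {n m : ℕ} {P RV RH : ℕ → ℕ → Prop}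
    (bottom : ∀ i ≤ n + 1, P i 0) (right : ∀ j ≤ m + 1, P (n + 1) j)
    (left : ∀ j ≤ m, ¬ P 0 (j + 1)) (top : ∀ i ≤ n, ¬ P i (m + 1))
    (start : RV 0 0)
    (cell : ∀ i < n + 1, ∀ j < m + 1, ∃ c : Prop,
      (¬(P i j ↔ P i (j + 1)) → (RV i j ↔ c)) ∧
      (¬(P (i + 1) j ↔ P (i + 1) (j + 1)) → (RV (i + 1) j ↔ c)) ∧
      (¬(P i j ↔ P (i + 1) j) → (RH i j ↔ c)) ∧
      (¬(P i (j + 1) ↔ P (i + 1) (j + 1)) → (RH i (j + 1) ↔ c))) :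
    RH n (m + 1) := by
  let V : ℕ → ℕ → ZMod 2 := fun i j => if ¬(P i j ↔ P i (j + 1)) ∧ RV i j then 1 else 0
  let H : ℕ → ℕ → ZMod 2 := fun i j => if ¬(P i j ↔ P (i + 1) j) ∧ RH i j then 1 else 0
  have hsum := boundary_sum_eq_zero (n := n + 1) (m := m + 1) (V := V) (H := H) <| by
    intro i hi j hj
    obtain ⟨c, h₁, h₂, h₃, h₄⟩ := cell i hi j hj
    simp only [V, H, and_congr_right h₁, and_congr_right h₂, and_congr_right h₃,
      and_congr_right h₄]
    by_cases c <;> by_cases P i j <;> by_cases P i (j + 1) <;> by_cases P (i + 1) j <;>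
      by_cases P (i + 1) (j + 1) <;> simp [*] <;> decide
  have hV : ∑ j ∈ Finset.range (m + 1), (V 0 j + V (n + 1) j) = 1 := by
    rw [Finset.sum_range_succ', Finset.sum_eq_zero]
    · simp [V, start, bottom, left, right]
    · intro j hj
      have hj := Finset.mem_range.1 hj
      simp [V, left j hj.le, left (j + 1) hj, right (j + 1) (by omega),
        right (j + 1 + 1) (by omega)]
  have hH : ∑ i ∈ Finset.range (n + 1), (H i 0 + H i (m + 1)) = H n (m + 1) := by
    rw [Finset.sum_range_succ, Finset.sum_eq_zero]
    · simp [H, bottom]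
    · intro i hi
      have hi := Finset.mem_range.1 hi
      simp [H, top i hi.le, top (i + 1) hi, bottom i (by omega), bottom (i + 1) (by omega)]
  rw [hV, hH] at hsum
  by_contra hR
  simp [H, hR] at hsum

theorem exists_eq_of_sign_change {φ : ℝ → ℝ} {a b v : ℝ} {P Q : Prop} (hab : a ≤ b)
    (hφ : ContinuousOn φ (Icc a b)) (hP : P → φ a ≤ v) (hP' : ¬P → v ≤ φ a)
    (hQ : Q → φ b ≤ v) (hQ' : ¬Q → v ≤ φ b) (h : ¬(P ↔ Q)) : ∃ t ∈ Icc a b, φ t = v := by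
  by_cases p : P
  · exact intermediate_value_Icc hab hφ ⟨hP p, hQ' fun q => h (iff_of_true p q)⟩
  · exact intermediate_value_Icc' hab hφ ⟨hQ (by tauto), hP' p⟩

theorem joinedIn_corners {T : ℝ} {f g : ℝ → ℝ}
    (hf : ContinuousOn f (Icc 0 1)) (hg : ContinuousOn g (Icc 0 1))
    (mf : MapsTo f (Icc 0 1) (Icc 0 T)) (mg : MapsTo g (Icc 0 1) (Icc 0 T))
    (f0 : f 0 = 0) (g0 : g 0 = 0) (f1 : f 1 = T) (g1 : g 1 = T)
    (pf : PiecewiseMonotoneOn f) (pg : PiecewiseMonotoneOn g) :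
    JoinedIn (equalHeight f g 0 1 0 1) (0, 0) (1, 1) := by
  obtain ⟨n, a, ma, a0, a1, ha⟩ := exists_nat_partition pf
  obtain ⟨m, b, mb, b0, b1, hb⟩ := exists_nat_partition pg
  have hlo {c : ℕ → ℝ} (mc : Monotone c) (c0 : c 0 = 0) (i : ℕ) : 0 ≤ c i :=
    c0 ▸ mc i.zero_le
  have hA {i : ℕ} (hi : i ≤ n + 1) : a i ∈ Icc (0 : ℝ) 1 := ⟨hlo ma a0 i, a1 ▸ ma hi⟩
  have hB {j : ℕ} (hj : j ≤ m + 1) : b j ∈ Icc (0 : ℝ) 1 := ⟨hlo mb b0 j, b1 ▸ mb hj⟩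
  have subA {i : ℕ} (hi : i < n + 1) : Icc (a i) (a (i + 1)) ⊆ Icc 0 1 :=
    Icc_subset_Icc (hA hi.le).1 (hA hi).2
  have subB {j : ℕ} (hj : j < m + 1) : Icc (b j) (b (j + 1)) ⊆ Icc 0 1 :=
    Icc_subset_Icc (hB hj.le).1 (hB hj).2
  let R : ℝ × ℝ → Prop := JoinedIn (equalHeight f g 0 1 0 1) (0, 0)
  have R_height {p : ℝ × ℝ} (h : R p) : f p.1 = g p.2 := h.target_mem.2
  have R_cell {i j : ℕ} (hi : i < n + 1) (hj : j < m + 1) {p q : ℝ × ℝ} (h : R p)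
      (hp : p ∈ Icc (a i) (a (i + 1)) ×ˢ Icc (b j) (b (j + 1)))
      (hq : q ∈ Icc (a i) (a (i + 1)) ×ˢ Icc (b j) (b (j + 1))) (e : f q.1 = g q.2) : R q :=
    h.trans <| (joinedIn_equalHeight (hf.mono (subA hi)) (hg.mono (subB hj)) (ha i hi) (hb j hj)
      ⟨hp, R_height h⟩ ⟨hq, e⟩).mono fun _ hr => ⟨⟨subA hi hr.1.1, subB hj hr.1.2⟩, hr.2⟩
  have h00 : R (0, 0) := JoinedIn.refl ⟨by simp, by simp [f0, g0]⟩
  -- The sign of `f - g` at the grid points, with ties broken along the boundary.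
  let P : ℕ → ℕ → Prop := fun i j =>
    i = n + 1 ∨ j = 0 ∨ (i ≠ 0 ∧ j ≠ m + 1 ∧ g (b j) ≤ f (a i))
  have P_le {i j : ℕ} (hi : i ≤ n + 1) (hj : j ≤ m + 1) (h : P i j) : g (b j) ≤ f (a i) := by
    obtain rfl | rfl | h := h
    · rw [a1, f1]
      exact (mg (hB hj)).2
    · rw [b0, g0]
      exact (mf (hA hi)).1
    · exact h.2.2
  have le_P {i j : ℕ} (hi : i ≤ n + 1) (hj : j ≤ m + 1) (h : ¬P i j) : f (a i) ≤ g (b j) := by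
    simp only [P, not_or, not_and_or, not_not, not_le] at h
    obtain ⟨-, -, rfl | rfl | h⟩ := h
    · rw [a0, f0]
      exact (mg (hB hj)).1
    · rw [b1, g1]
      exact (mf (hA hi)).2
    · exact h.le
  have cross_V {i j : ℕ} (hi : i ≤ n + 1) (hj : j < m + 1) (h : ¬(P i j ↔ P i (j + 1))) :
      ∃ y ∈ Icc (b j) (b (j + 1)), g y = f (a i) :=
    exists_eq_of_sign_change (mb j.le_succ) (hg.mono (subB hj)) (P_le hi hj.le) (le_P hi hj.le)
      (P_le hi hj) (le_P hi hj) h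
  have cross_H {i j : ℕ} (hi : i < n + 1) (hj : j ≤ m + 1) (h : ¬(P i j ↔ P (i + 1) j)) :
      ∃ x ∈ Icc (a i) (a (i + 1)), f x = g (b j) :=
    exists_eq_of_sign_change (P := ¬P i j) (Q := ¬P (i + 1) j) (ma i.le_succ)
      (hf.mono (subA hi)) (le_P hi.le hj) (fun h => P_le hi.le hj (not_not.1 h)) (le_P hi hj)
      (fun h => P_le hi hj (not_not.1 h)) (fun h' => h (not_iff_not.1 h'))
  have last : ∃ x ∈ Icc (a n) (a (n + 1)), R (x, b (m + 1)) := by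
    refine reach_last_edge (P := P) (RV := fun i j => ∃ y ∈ Icc (b j) (b (j + 1)), R (a i, y))
      (RH := fun i j => ∃ x ∈ Icc (a i) (a (i + 1)), R (x, b j)) ?_ ?_ ?_ ?_ ?_ ?_
    · simp [P]
    · simp [P]
    · simp [P]
    · intro i hi
      simp [P]
      omega
    · exact ⟨0, ⟨b0.le, hlo mb b0 1⟩, by rwa [a0]⟩
    · intro i hi j hj
      have la : a i ≤ a (i + 1) := ma i.le_succ
      have lb : b j ≤ b (j + 1) := mb j.le_succ
      refine ⟨∃ p ∈ Icc (a i) (a (i + 1)) ×ˢ Icc (b j) (b (j + 1)), R p, ?_, ?_, ?_, ?_⟩ <;>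
        intro h <;> constructor
      · rintro ⟨y, hy, hR⟩
        exact ⟨_, ⟨⟨le_rfl, la⟩, hy⟩, hR⟩
      · rintro ⟨p, hp, hR⟩
        obtain ⟨y, hy, e⟩ := cross_V hi.le hj h
        exact ⟨y, hy, R_cell hi hj hR hp ⟨⟨le_rfl, la⟩, hy⟩ e.symm⟩
      · rintro ⟨y, hy, hR⟩
        exact ⟨_, ⟨⟨la, le_rfl⟩, hy⟩, hR⟩
      · rintro ⟨p, hp, hR⟩
        obtain ⟨y, hy, e⟩ := cross_V hi hj h
        exact ⟨y, hy, R_cell hi hj hR hp ⟨⟨la, le_rfl⟩, hy⟩ e.symm⟩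
      · rintro ⟨x, hx, hR⟩
        exact ⟨_, ⟨hx, ⟨le_rfl, lb⟩⟩, hR⟩
      · rintro ⟨p, hp, hR⟩
        obtain ⟨x, hx, e⟩ := cross_H hi hj.le h
        exact ⟨x, hx, R_cell hi hj hR hp ⟨hx, ⟨le_rfl, lb⟩⟩ e⟩
      · rintro ⟨x, hx, hR⟩
        exact ⟨_, ⟨hx, ⟨lb, le_rfl⟩⟩, hR⟩
      · rintro ⟨p, hp, hR⟩
        obtain ⟨x, hx, e⟩ := cross_H hi hj h
        exact ⟨x, hx, R_cell hi hj hR hp ⟨hx, ⟨lb, le_rfl⟩⟩ e⟩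
  obtain ⟨x, hx, hR⟩ := last
  exact R_cell n.lt_succ_self m.lt_succ_self hR ⟨hx, mb m.le_succ, le_rfl⟩
    ⟨⟨a1 ▸ ma n.le_succ, a1.ge⟩, ⟨b1 ▸ mb m.le_succ, b1.ge⟩⟩ (f1.trans g1.symm)

end MountainClimbing

/-- Mountain Climbing Theorem (Whittaker 1966). -/
theorem mountain_climbing (T : ℝ) (γ₁ γ₂ : ℝ → ℝ)
    (hc₁ : ContinuousOn γ₁ (Set.Icc 0 1)) (hc₂ : ContinuousOn γ₂ (Set.Icc 0 1))
    (hm₁ : Set.MapsTo γ₁ (Set.Icc 0 1) (Set.Icc 0 T))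
    (hm₂ : Set.MapsTo γ₂ (Set.Icc 0 1) (Set.Icc 0 T))
    (h₁0 : γ₁ 0 = 0) (h₂0 : γ₂ 0 = 0) (h₁1 : γ₁ 1 = T) (h₂1 : γ₂ 1 = T)
    (hp₁ : PiecewiseMonotoneOn γ₁) (hp₂ : PiecewiseMonotoneOn γ₂) :
    ∃ γ₁' γ₂' : ℝ → ℝ,
      ContinuousOn γ₁' (Set.Icc 0 1) ∧ ContinuousOn γ₂' (Set.Icc 0 1) ∧
      Set.MapsTo γ₁' (Set.Icc 0 1) (Set.Icc 0 1) ∧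
      Set.MapsTo γ₂' (Set.Icc 0 1) (Set.Icc 0 1) ∧
      γ₁' 0 = 0 ∧ γ₂' 0 = 0 ∧ γ₁' 1 = 1 ∧ γ₂' 1 = 1 ∧
      ∀ t ∈ Set.Icc (0:ℝ) 1, γ₁ (γ₁' t) = γ₂ (γ₂' t) := by
  obtain ⟨γ, hγ⟩ := MountainClimbing.joinedIn_corners hc₁ hc₂ hm₁ hm₂ h₁0 h₂0 h₁1 h₂1 hp₁ hp₂
  have mem (t : ℝ) : γ.extend t ∈ MountainClimbing.equalHeight γ₁ γ₂ 0 1 0 1 := hγ _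
  have hγc : Continuous γ.extend := γ.continuous_extend
  exact ⟨fun t => (γ.extend t).1, fun t => (γ.extend t).2, hγc.fst.continuousOn,
    hγc.snd.continuousOn, fun t _ => (mem t).1.1, fun t _ => (mem t).1.2, by simp, by simp,
    by simp, by simp, fun t _ => (mem t).2⟩
end

section
/- Let C : S¹ → ℝ³ be a rectifiable closed curve, p a point in the convex hull of the image of C, and K the p-cone of C (the disk K(x,y) = y·C(x) + (1−y)·p). Let r ≥ 0 and x, y ∈ K with dist(x, im C) ≥ r and dist(y, im C) ≥ r. Then length(C) ≥ 2πr + 2‖x − y‖. -/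
open Metric

/-- The point of the plane with polar coordinates `(ρ, θ)`. -/
noncomputable def polarPoint (ρ θ : ℝ) : ℂ := ⟨ρ * Real.cos θ, ρ * Real.sin θ⟩

lemma inner_polarPoint (ρ θ σ φ : ℝ) :
    inner ℝ (polarPoint ρ θ) (polarPoint σ φ) = ρ * σ * Real.cos (θ - φ) := by
  simp only [polarPoint, Complex.inner, Complex.mul_re, Complex.conj_re, Complex.conj_im,
    Real.cos_sub]
  ring

lemma norm_polarPoint {ρ : ℝ} (hρ : 0 ≤ ρ) (θ : ℝ) : ‖polarPoint ρ θ‖ = ρ := by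
  have h := inner_polarPoint ρ θ ρ θ
  rw [real_inner_self_eq_norm_sq, sub_self, Real.cos_zero, mul_one, ← sq] at h
  exact (pow_left_inj₀ (norm_nonneg _) hρ two_ne_zero).1 h

lemma norm_sub_polarPoint_sq {ρ σ : ℝ} (hρ : 0 ≤ ρ) (hσ : 0 ≤ σ) (θ φ : ℝ) :
    ‖polarPoint ρ θ - polarPoint σ φ‖ ^ 2 =
      ρ ^ 2 + σ ^ 2 - 2 * (ρ * σ * Real.cos (θ - φ)) := by
  rw [norm_sub_sq_real, inner_polarPoint, norm_polarPoint hρ, norm_polarPoint hσ]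
  ring

lemma polarPoint_add_two_pi_mul (ρ θ : ℝ) (n : ℤ) :
    polarPoint ρ (θ + n * (2 * Real.pi)) = polarPoint ρ θ := by
  simp [polarPoint, Real.cos_add_int_mul_two_pi, Real.sin_add_int_mul_two_pi]

lemma polarPoint_neg (ρ θ : ℝ) : polarPoint ρ (-θ) = (starRingEnd ℂ) (polarPoint ρ θ) := by
  apply Complex.ext <;> simp [polarPoint]

lemma polarPoint_add_pi (ρ θ : ℝ) : polarPoint ρ (θ + Real.pi) = -polarPoint ρ θ := by
  apply Complex.ext <;> simp [polarPoint]

lemma exists_polarPoint_eq (w : ℂ) : w = polarPoint ‖w‖ w.arg := by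
  apply Complex.ext <;> simp [polarPoint]

lemma abs_cos_sub_periodic (χ : ℝ) :
    Function.Periodic (fun ψ : ℝ => |Real.cos (χ - ψ)|) Real.pi := by
  intro ψ
  simp only
  rw [show χ - (ψ + Real.pi) = (χ - ψ) - Real.pi by ring, Real.cos_sub_pi, abs_neg]

lemma integral_abs_inner_polarPoint (w : ℂ) :
    ∫ ψ in (0:ℝ)..Real.pi, |inner ℝ w (polarPoint 1 ψ)| = 2 * ‖w‖ := by
  have h : ∀ ψ, |inner ℝ w (polarPoint 1 ψ)| = ‖w‖ * |Real.cos (w.arg - ψ)| := by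
    intro ψ
    conv_lhs => rw [exists_polarPoint_eq w]
    rw [inner_polarPoint, mul_one, abs_mul, abs_norm]
  simp only [h]
  rw [intervalIntegral.integral_const_mul]
  have h1 := (abs_cos_sub_periodic w.arg).intervalIntegral_add_eq 0 (w.arg - Real.pi / 2)
  rw [zero_add] at h1
  rw [h1, intervalIntegral.integral_comp_sub_left (fun x => |Real.cos x|)]
  have h2 : ∫ x in (w.arg - (w.arg - Real.pi / 2 + Real.pi))..(w.arg - (w.arg - Real.pi / 2)),
      |Real.cos x| = ∫ x in (-(Real.pi / 2))..(Real.pi / 2), Real.cos x := by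
    rw [show w.arg - (w.arg - Real.pi / 2 + Real.pi) = -(Real.pi / 2) by ring,
      show w.arg - (w.arg - Real.pi / 2) = Real.pi / 2 by ring]
    refine intervalIntegral.integral_congr fun x hx => ?_
    rw [Set.uIcc_of_le (by linarith [Real.pi_pos])] at hx
    exact abs_of_nonneg (Real.cos_nonneg_of_mem_Icc hx)
  rw [h2, integral_cos]
  simp
  ring

/-- Discrete intermediate value theorem. -/
lemma exists_sign_change (D : ℕ → ℝ) {j : ℕ} (h0 : D 0 ≤ 0) (hj : 0 < j) (hDj : 0 ≤ D j) :
    ∃ i < j, D i ≤ 0 ∧ 0 ≤ D (i + 1) := by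
  induction j with
  | zero => omega
  | succ n ih =>
    rcases le_total (D n) 0 with h | h
    · exact ⟨n, by omega, h, hDj⟩
    · rcases Nat.eq_zero_or_pos n with rfl | hn
      · exact ⟨0, by omega, h0, hDj⟩
      · obtain ⟨i, hi, h⟩ := ih hn h
        exact ⟨i, by omega, h⟩

/-- A ray issuing from a point of the segment joining the origin to the first vertex of a
polygonal line which turns around the origin meets that line before the line reaches the
direction of the ray. -/
lemma exists_ray_crossing {ρ f : ℕ → ℝ} {m : ℕ} {s ψ : ℝ} (hρ : ∀ i, 0 ≤ ρ i)
    (hf : ∀ i < m, f i ≤ f (i + 1)) (hf' : ∀ i < m, f (i + 1) ≤ f i + Real.pi)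
    (hs : 0 ≤ s) (hs' : s ≤ ρ 0) (h0 : f 0 < ψ) (hπ : ψ < f 0 + Real.pi) (hm : ψ ≤ f m) :
    ∃ i < m, ∃ l ∈ Set.Icc (0:ℝ) 1, ∃ t : ℝ, 0 ≤ t ∧
      (1 - l) • polarPoint (ρ i) (f i) + l • polarPoint (ρ (i + 1)) (f (i + 1)) =
        polarPoint s (f 0) + t • polarPoint 1 ψ := by
  classical
  have hex : ∃ j, ψ ≤ f j := ⟨m, hm⟩
  set j := Nat.find hex with hj
  have hjψ : ψ ≤ f j := Nat.find_spec hex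
  have hjm : j ≤ m := Nat.find_min' hex hm
  have hlt : ∀ i < j, f i < ψ := fun i hi => not_le.1 (Nat.find_min hex hi)
  have hjpos : 0 < j := by
    rcases Nat.eq_zero_or_pos j with h | h
    · rw [h] at hjψ; linarith
    · exact h
  have hmono : ∀ i ≤ m, f 0 ≤ f i := by
    intro i hi
    induction i with
    | zero => exact le_rfl
    | succ n ih => exact (ih (by omega)).trans (hf n (by omega))
  have hω : 0 < Real.sin (ψ - f 0) := Real.sin_pos_of_pos_of_lt_pi (by linarith) (by linarith)
  set D : ℕ → ℝ := fun i => ρ i * Real.sin (f i - ψ) + s * Real.sin (ψ - f 0) with hD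
  have hD0 : D 0 ≤ 0 := by
    have : D 0 = (s - ρ 0) * Real.sin (ψ - f 0) := by
      simp only [hD]
      rw [← neg_sub ψ (f 0), Real.sin_neg]; ring
    rw [this]
    exact mul_nonpos_of_nonpos_of_nonneg (by linarith) hω.le
  have hDj : 0 ≤ D j := by
    obtain ⟨n, hn⟩ : ∃ n, j = n + 1 := ⟨j - 1, by omega⟩
    have h1 := hlt n (by omega)
    have h2 := hf' n (by omega)
    rw [← hn] at h2
    have : 0 ≤ Real.sin (f j - ψ) :=
      Real.sin_nonneg_of_nonneg_of_le_pi (by linarith) (by linarith)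
    have := hρ j
    simp only [hD]
    positivity
  obtain ⟨i, hij, hi0, hi1⟩ := exists_sign_change D hD0 hjpos hDj
  obtain ⟨l, hl0, hl1, hl⟩ : ∃ l : ℝ, 0 ≤ l ∧ l ≤ 1 ∧ (1 - l) * D i + l * D (i + 1) = 0 := by
    rcases eq_or_lt_of_le (hi0.trans hi1) with h | h
    · exact ⟨0, le_rfl, zero_le_one, by linarith⟩
    · refine ⟨-D i / (D (i + 1) - D i), div_nonneg (by linarith) (by linarith), ?_, ?_⟩
      · rw [div_le_one (by linarith)]; linarith
      · have : D (i + 1) - D i ≠ 0 := by linarith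
        field_simp
        ring
  set a := (1 - l) * ρ i with ha
  set b := l * ρ (i + 1) with hb
  have ha0 : 0 ≤ a := mul_nonneg (by linarith) (hρ _)
  have hb0 : 0 ≤ b := mul_nonneg hl0 (hρ _)
  have hcross : a * Real.sin (f i - ψ) + b * Real.sin (f (i + 1) - ψ) =
      -(s * Real.sin (ψ - f 0)) := by
    simp only [hD] at hl
    rw [ha, hb]
    linear_combination hl
  set t := a * Real.cos (f i - ψ) + b * Real.cos (f (i + 1) - ψ) - s * Real.cos (ψ - f 0) with ht
  have hiψ := hlt i hij
  have hi_low := hmono i (by omega)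
  have hstep := hf i (by omega)
  have hstep' := hf' i (by omega)
  have htsin : t * Real.sin (ψ - f 0) =
      a * Real.sin (f i - f 0) + b * Real.sin (f (i + 1) - f 0) := by
    have e1 : Real.sin (f i - f 0) = Real.sin (f i - ψ) * Real.cos (ψ - f 0) +
        Real.cos (f i - ψ) * Real.sin (ψ - f 0) := by rw [← Real.sin_add]; congr 1; ring
    have e2 : Real.sin (f (i + 1) - f 0) = Real.sin (f (i + 1) - ψ) * Real.cos (ψ - f 0) +
        Real.cos (f (i + 1) - ψ) * Real.sin (ψ - f 0) := by rw [← Real.sin_add]; congr 1; ring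
    rw [e1, e2, ht]
    linear_combination -Real.cos (ψ - f 0) * hcross
  have hpos : 0 ≤ a * Real.sin (f i - f 0) + b * Real.sin (f (i + 1) - f 0) := by
    have hsi : 0 ≤ Real.sin (f i - f 0) :=
      Real.sin_nonneg_of_nonneg_of_le_pi (by linarith) (by linarith)
    rcases le_or_gt (f (i + 1)) (f 0 + Real.pi) with h | h
    · have : 0 ≤ Real.sin (f (i + 1) - f 0) :=
        Real.sin_nonneg_of_nonneg_of_le_pi (by linarith) (by linarith)
      positivity
    · have hp : 0 < Real.sin (f (i + 1) - ψ) :=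
        Real.sin_pos_of_pos_of_lt_pi (by linarith) (by linarith)
      have hn : Real.sin (f (i + 1) - f 0) ≤ 0 := by
        have : 0 ≤ Real.sin (f (i + 1) - f 0 - Real.pi) :=
          Real.sin_nonneg_of_nonneg_of_le_pi (by linarith) (by linarith)
        rw [Real.sin_sub_pi] at this
        linarith
      have hid : Real.sin (f (i + 1) - ψ) * Real.sin (f i - f 0) -
          Real.sin (f i - ψ) * Real.sin (f (i + 1) - f 0) =
          Real.sin (ψ - f 0) * Real.sin (f (i + 1) - f i) := by
        simp only [Real.sin_sub]
        ring
      have hs2 : 0 ≤ Real.sin (f (i + 1) - f i) :=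
        Real.sin_nonneg_of_nonneg_of_le_pi (by linarith) (by linarith)
      have hle : b * Real.sin (f (i + 1) - ψ) ≤ -(a * Real.sin (f i - ψ)) := by
        have := mul_nonneg hs hω.le
        linarith
      have hmul := mul_le_mul_of_nonpos_right hle hn
      have key : 0 ≤ (a * Real.sin (f i - f 0) + b * Real.sin (f (i + 1) - f 0)) *
          Real.sin (f (i + 1) - ψ) := by
        have : 0 ≤ a * (Real.sin (ψ - f 0) * Real.sin (f (i + 1) - f i)) := by positivity
        rw [← hid] at this
        nlinarith
      exact nonneg_of_mul_nonneg_left key hp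
  refine ⟨i, by omega, l, ⟨hl0, hl1⟩, t, ?_, ?_⟩
  · rw [← htsin] at hpos
    exact nonneg_of_mul_nonneg_left hpos hω
  · have c1 : a * Real.cos (f i) + b * Real.cos (f (i + 1)) =
        s * Real.cos (f 0) + t * Real.cos ψ := by
      have h1 := hcross
      have h2 := ht
      simp only [Real.sin_sub, Real.cos_sub] at h1 h2
      have := Real.sin_sq_add_cos_sq ψ
      linear_combination (-Real.cos ψ) * h2 + (-Real.sin ψ) * h1 -
        (a * Real.cos (f i) + b * Real.cos (f (i + 1)) - s * Real.cos (f 0)) * this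
    have c2 : a * Real.sin (f i) + b * Real.sin (f (i + 1)) =
        s * Real.sin (f 0) + t * Real.sin ψ := by
      have h1 := hcross
      have h2 := ht
      simp only [Real.sin_sub, Real.cos_sub] at h1 h2
      have := Real.sin_sq_add_cos_sq ψ
      linear_combination (-Real.sin ψ) * h2 + Real.cos ψ * h1 -
        (a * Real.sin (f i) + b * Real.sin (f (i + 1)) - s * Real.sin (f 0)) * this
    apply Complex.ext
    · simp [polarPoint]
      linear_combination c1
    · simp [polarPoint]
      linear_combination c2

/-- Along every ray issuing from `polarPoint s (f 0)` and making an acute angle with `W`, the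
polygonal line reaches height `r - ε` above its origin. -/
lemma exists_inner_ge_of_turning {ρ f : ℕ → ℝ} {m : ℕ} {s ψ r ε : ℝ} {W : ℂ}
    (hρ : ∀ i, 0 ≤ ρ i)
    (hf : ∀ i < m, f i ≤ f (i + 1)) (hf' : ∀ i < m, f (i + 1) ≤ f i + Real.pi)
    (hs : 0 ≤ s) (hs' : s ≤ ρ 0) (h0 : f 0 < ψ) (hπ : ψ < f 0 + Real.pi) (hm : ψ ≤ f m)
    (hε : ∀ i < m,
      ‖polarPoint (ρ (i + 1)) (f (i + 1)) - polarPoint (ρ i) (f i)‖ ≤ ε)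
    (hr : ∀ i ≤ m, 0 ≤ inner ℝ (polarPoint (ρ i) (f i) - polarPoint s (f 0)) W →
      r ≤ ‖polarPoint (ρ i) (f i) - polarPoint s (f 0)‖)
    (hW : 0 ≤ inner ℝ W (polarPoint 1 ψ)) :
    ∃ i ≤ m, inner ℝ (polarPoint s (f 0)) (polarPoint 1 ψ) + (r - ε) ≤
      inner ℝ (polarPoint (ρ i) (f i)) (polarPoint 1 ψ) := by
  obtain ⟨i, him, l, ⟨hl0, hl1⟩, t, ht, heq⟩ :=
    exists_ray_crossing hρ hf hf' hs hs' h0 hπ hm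
  set U := polarPoint s (f 0)
  set e := polarPoint 1 ψ with he
  set x := polarPoint (ρ i) (f i) with hx
  set y := polarPoint (ρ (i + 1)) (f (i + 1)) with hy
  have hxy : ‖y - x‖ ≤ ε := hε i him
  have hee : inner ℝ e e = (1:ℝ) := by rw [he, inner_polarPoint]; simp
  have hne : ‖e‖ = 1 := norm_polarPoint zero_le_one ψ
  have hsec : 0 ≤ (1 - l) * inner ℝ (x - U) W + l * inner ℝ (y - U) W := by
    have h1 : (1 - l) * inner ℝ (x - U) W + l * inner ℝ (y - U) W = t * inner ℝ W e := by
      rw [← real_inner_smul_left, ← real_inner_smul_left, ← inner_add_left, real_inner_comm e W,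
        ← real_inner_smul_left]
      congr 1
      linear_combination (norm := module) heq
    rw [h1]; positivity
  have hrt : r - ε ≤ t := by
    rcases le_or_gt 0 (inner ℝ (x - U) W) with h | h
    · have h1 := hr i him.le h
      have h2 : x - U = t • e - l • (y - x) := by
        linear_combination (norm := module) heq
      have h3 : ‖x - U‖ ≤ t + l * ‖y - x‖ := by
        rw [h2]
        refine (norm_sub_le _ _).trans ?_
        rw [norm_smul, norm_smul, hne, Real.norm_of_nonneg ht, Real.norm_of_nonneg hl0, mul_one]
      have h4 : l * ‖y - x‖ ≤ 1 * ε :=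
        mul_le_mul hl1 hxy (norm_nonneg _) zero_le_one
      linarith
    · have hpos : 0 ≤ inner ℝ (y - U) W := by
        by_contra hcon
        push Not at hcon
        rcases eq_or_lt_of_le hl0 with h' | h'
        · subst h'; linarith
        · have := mul_neg_of_pos_of_neg h' hcon
          have := mul_nonpos_of_nonneg_of_nonpos (sub_nonneg.2 hl1) h.le
          linarith
      have h1 := hr (i + 1) him hpos
      have h2 : y - U = t • e + (1 - l) • (y - x) := by
        linear_combination (norm := module) heq
      have h3 : ‖y - U‖ ≤ t + (1 - l) * ‖y - x‖ := by
        rw [h2]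
        refine (norm_add_le _ _).trans ?_
        rw [norm_smul, norm_smul, hne, Real.norm_of_nonneg ht,
          Real.norm_of_nonneg (sub_nonneg.2 hl1), mul_one]
      have h4 : (1 - l) * ‖y - x‖ ≤ 1 * ε :=
        mul_le_mul (by linarith) hxy (norm_nonneg _) zero_le_one
      linarith
  have hin : (1 - l) * inner ℝ x e + l * inner ℝ y e = inner ℝ U e + t := by
    have := congrArg (fun z => inner ℝ z e) heq
    simpa only [inner_add_left, real_inner_smul_left, hee, mul_one] using this
  rcases le_total (inner ℝ x e) (inner ℝ y e) with h | h
  · refine ⟨i + 1, him, ?_⟩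
    nlinarith [mul_le_mul_of_nonneg_left h (sub_nonneg.2 hl1)]
  · refine ⟨i, him.le, ?_⟩
    nlinarith [mul_le_mul_of_nonneg_left h hl0]

lemma exists_int_mul_two_pi_mem (β ψ : ℝ) (h : Real.sin (ψ - β) ≠ 0) :
    ∃ n : ℤ, (β < ψ + n * (2 * Real.pi) ∧ ψ + n * (2 * Real.pi) < β + Real.pi) ∨
      (β - Real.pi < ψ + n * (2 * Real.pi) ∧ ψ + n * (2 * Real.pi) < β) := by
  obtain ⟨n, hn, -⟩ := existsUnique_add_zsmul_mem_Ioc Real.two_pi_pos ψ (β - Real.pi)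
  refine ⟨n, ?_⟩
  rw [zsmul_eq_mul] at hn
  have h1 : ψ + n * (2 * Real.pi) ≠ β := by
    intro h'
    apply h
    rw [show ψ - β = (0:ℝ) - n * (2 * Real.pi) by linarith, Real.sin_sub_int_mul_two_pi,
      Real.sin_zero]
  have h2 : ψ + n * (2 * Real.pi) ≠ β + Real.pi := by
    intro h'
    apply h
    rw [show ψ - β = Real.pi - n * (2 * Real.pi) by linarith, Real.sin_sub_int_mul_two_pi,
      Real.sin_pi]
  rcases lt_or_gt_of_ne h1 with h3 | h3
  · exact Or.inr ⟨hn.1, h3⟩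
  · exact Or.inl ⟨h3, lt_of_le_of_ne (by linarith [hn.2]) h2⟩

lemma inner_conj_conj (z w : ℂ) :
    inner ℝ ((starRingEnd ℂ) z) ((starRingEnd ℂ) w) = inner ℝ z w := by
  simp [Complex.inner]

lemma exists_inner_ge_of_winding {ρ f : ℕ → ℝ} {N k : ℕ} {s ψ r ε : ℝ} {W : ℂ}
    (hρ : ∀ i, 0 ≤ ρ i) (hfN : ∀ i, f (i + N) = f i + 2 * Real.pi) (hk : N ≤ k)
    (hf : ∀ i, f i ≤ f (i + 1)) (hf' : ∀ i, f (i + 1) ≤ f i + Real.pi)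
    (hs : 0 ≤ s) (hs' : s ≤ ρ k) (hψ : Real.sin (ψ - f k) ≠ 0)
    (hε : ∀ i, ‖polarPoint (ρ (i + 1)) (f (i + 1)) - polarPoint (ρ i) (f i)‖ ≤ ε)
    (hr : ∀ i, 0 ≤ inner ℝ (polarPoint (ρ i) (f i) - polarPoint s (f k)) W →
      r ≤ ‖polarPoint (ρ i) (f i) - polarPoint s (f k)‖)
    (hW : 0 ≤ inner ℝ W (polarPoint 1 ψ)) :
    ∃ i, inner ℝ (polarPoint s (f k)) (polarPoint 1 ψ) + (r - ε) ≤
      inner ℝ (polarPoint (ρ i) (f i)) (polarPoint 1 ψ) := by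
  have hpi := Real.pi_pos
  obtain ⟨n, hn⟩ := exists_int_mul_two_pi_mem (f k) ψ hψ
  rw [← polarPoint_add_two_pi_mul 1 ψ n] at hW ⊢
  set χ := ψ + n * (2 * Real.pi)
  rcases hn with ⟨h1, h2⟩ | ⟨h1, h2⟩
  · have key := exists_inner_ge_of_turning (ρ := fun i => ρ (k + i)) (f := fun i => f (k + i))
      (m := N) (s := s) (ψ := χ) (r := r) (ε := ε) (W := W) (fun i => hρ _)
      (fun i _ => hf _) (fun i _ => hf' _) hs hs' h1 h2
      (by have := hfN k; simp only [this]; linarith) (fun i _ => hε _) (fun i _ => hr _) hW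
    obtain ⟨i, -, hi⟩ := key
    exact ⟨k + i, hi⟩
  · have hsucc : ∀ i < N, k - i = (k - (i + 1)) + 1 := fun i hi => by omega
    have key := exists_inner_ge_of_turning (ρ := fun i => ρ (k - i)) (f := fun i => -f (k - i))
      (m := N) (s := s) (ψ := -χ) (r := r) (ε := ε) (W := (starRingEnd ℂ) W) (fun i => hρ _)
      (fun i hi => by rw [hsucc i hi]; linarith [hf (k - (i + 1))])
      (fun i hi => by rw [hsucc i hi]; linarith [hf' (k - (i + 1))]) hs hs'
      (by simp only [Nat.sub_zero]; linarith) (by simp only [Nat.sub_zero]; linarith)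
      (by
        have := hfN (k - N)
        rw [Nat.sub_add_cancel hk] at this
        linarith)
      (fun i hi => by
        simp only [polarPoint_neg]
        rw [← map_sub, RCLike.norm_conj, hsucc i hi, norm_sub_rev]
        exact hε _)
      (fun i _ => by
        simp only [polarPoint_neg, Nat.sub_zero]
        rw [← map_sub, RCLike.norm_conj, inner_conj_conj]
        exact hr _)
      (by rw [polarPoint_neg, inner_conj_conj]; exact hW)
    obtain ⟨i, -, hi⟩ := key
    simp only [polarPoint_neg, Nat.sub_zero, inner_conj_conj] at hi
    exact ⟨k - i, hi⟩

lemma sum_range_periodic_shift {M : Type*} [AddCommGroup M] {F : ℕ → M} {N : ℕ}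
    (hF : ∀ i, F (i + N) = F i) (k : ℕ) :
    ∑ i ∈ Finset.range N, F (i + k) = ∑ i ∈ Finset.range N, F i := by
  induction k with
  | zero => rfl
  | succ k ih =>
    have h1 := Finset.sum_range_succ (fun i => F (i + k)) N
    have h2 := Finset.sum_range_succ' (fun i => F (i + k)) N
    rw [h1] at h2
    rw [← ih]
    have h3 : F (N + k) = F (0 + k) := by rw [add_comm N k, hF, zero_add]
    rw [h3] at h2
    rw [add_right_cancel h2]
    exact Finset.sum_congr rfl fun i _ => by congr 1; omega

/-- A periodic real sequence has total variation over a period at least twice its oscillation. -/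
lemma two_mul_sub_le_sum_abs_sub {x : ℕ → ℝ} {N : ℕ} (hN : 0 < N)
    (hx : ∀ i, x (i + N) = x i) (i j : ℕ) :
    2 * (x i - x j) ≤ ∑ l ∈ Finset.range N, |x (l + 1) - x l| := by
  have hper : ∀ n a, x (a + n * N) = x a := by
    intro n a
    induction n with
    | zero => simp
    | succ n ih => rw [add_mul, one_mul, ← add_assoc, hx, ih]
  obtain ⟨b, hb, hxb⟩ : ∃ b < N, x (j + b) = x i := by
    refine ⟨(i + j * N - j) % N, Nat.mod_lt _ hN, ?_⟩
    have hj : j ≤ j * N := Nat.le_mul_of_pos_right _ hN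
    rw [← hper ((i + j * N - j) / N), add_assoc, Nat.mod_add_div', ← Nat.add_sub_assoc (by omega),
      Nat.add_sub_cancel_left, hper]
  have hshift := sum_range_periodic_shift (F := fun l => |x (l + 1) - x l|) (N := N)
    (fun l => by rw [show l + N + 1 = l + 1 + N by ring, hx, hx]) j
  rw [← hshift, ← Finset.sum_range_add_sum_Ico _ hb.le]
  have e1 := dist_le_range_sum_dist (fun l => x (l + j)) b
  have e2 := dist_le_Ico_sum_dist (fun l => x (l + j)) hb.le
  simp only [Real.dist_eq] at e1 e2
  rw [zero_add, add_comm b j, hxb] at e1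
  rw [add_comm b j, hxb, add_comm N j, hx] at e2
  have s1 : ∀ l, |x (l + j) - x (l + 1 + j)| = |x (l + j + 1) - x (l + j)| := by
    intro l
    rw [abs_sub_comm]; congr 3; omega
  simp only [s1] at e1 e2
  have := neg_abs_le (x j - x i)
  have := le_abs_self (x i - x j)
  linarith

lemma ae_sin_sub_ne_zero (c : ℝ) :
    ∀ᵐ ψ : ℝ ∂MeasureTheory.volume, Real.sin (ψ - c) ≠ 0 := by
  rw [MeasureTheory.ae_iff]
  refine Set.Countable.measure_zero ?_ _
  refine (Set.countable_range fun n : ℤ => n * Real.pi + c).mono ?_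
  intro ψ hψ
  simp only [ne_eq, not_not, Set.mem_ofPred_eq] at hψ
  obtain ⟨n, hn⟩ := Real.sin_eq_zero_iff.1 hψ
  exact ⟨n, by simp only [hn]; ring⟩

lemma continuous_abs_inner_polarPoint (w : ℂ) :
    Continuous fun ψ : ℝ => |inner ℝ w (polarPoint 1 ψ)| := by
  simp only [polarPoint, Complex.inner, Complex.mul_re, Complex.conj_re, Complex.conj_im]
  fun_prop

/-- The planar two-point inequality for a polygon turning once around the origin. -/
lemma planar_two_point_inequality {ρ f : ℕ → ℝ} {N k : ℕ} {s s' r ε : ℝ} (hN : 0 < N)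
    (hρ : ∀ i, 0 ≤ ρ i) (hρN : ∀ i, ρ (i + N) = ρ i)
    (hfN : ∀ i, f (i + N) = f i + 2 * Real.pi)
    (hf : ∀ i, f i ≤ f (i + 1)) (hf' : ∀ i, f (i + 1) ≤ f i + Real.pi)
    (hs : 0 ≤ s) (hs1 : s ≤ ρ 0) (hs' : 0 ≤ s') (hs1' : s' ≤ ρ k)
    (hε : ∀ i, ‖polarPoint (ρ (i + 1)) (f (i + 1)) - polarPoint (ρ i) (f i)‖ ≤ ε)
    (hr : ∀ i, 0 ≤ inner ℝ (polarPoint (ρ i) (f i) - polarPoint s (f 0))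
        (polarPoint s (f 0) - polarPoint s' (f k)) →
      r ≤ ‖polarPoint (ρ i) (f i) - polarPoint s (f 0)‖)
    (hr' : ∀ i, 0 ≤ inner ℝ (polarPoint (ρ i) (f i) - polarPoint s' (f k))
        (polarPoint s' (f k) - polarPoint s (f 0)) →
      r ≤ ‖polarPoint (ρ i) (f i) - polarPoint s' (f k)‖) :
    2 * Real.pi * (r - ε) + 2 * ‖polarPoint s (f 0) - polarPoint s' (f k)‖ ≤
      ∑ i ∈ Finset.range N,
        ‖polarPoint (ρ (i + 1)) (f (i + 1)) - polarPoint (ρ i) (f i)‖ := by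
  have hper : ∀ σ i, polarPoint σ (f (i + N)) = polarPoint σ (f i) := by
    intro σ i
    rw [hfN]
    simpa using polarPoint_add_two_pi_mul σ (f i) 1
  set U := polarPoint s (f 0) with hU
  set V := polarPoint s' (f k) with hV
  have hsinN : ∀ ψ i, Real.sin (ψ - f (i + N)) = Real.sin (ψ - f i) := by
    intro ψ i
    rw [hfN, ← sub_sub, Real.sin_sub_two_pi]
  have reachU : ∀ ψ, Real.sin (ψ - f 0) ≠ 0 → 0 ≤ inner ℝ (U - V) (polarPoint 1 ψ) →
      ∃ i, inner ℝ U (polarPoint 1 ψ) + (r - ε) ≤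
        inner ℝ (polarPoint (ρ i) (f i)) (polarPoint 1 ψ) := by
    intro ψ hψ hW
    have := exists_inner_ge_of_winding (k := 0 + N) (ψ := ψ) (r := r) (W := U - V) hρ hfN
      (by omega) hf hf' hs (by rwa [hρN]) (by rwa [hsinN]) hε (by rw [hper]; exact hr) hW
    rwa [hper] at this
  have reachV : ∀ ψ, Real.sin (ψ - f k) ≠ 0 → 0 ≤ inner ℝ (V - U) (polarPoint 1 ψ) →
      ∃ i, inner ℝ V (polarPoint 1 ψ) + (r - ε) ≤
        inner ℝ (polarPoint (ρ i) (f i)) (polarPoint 1 ψ) := by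
    intro ψ hψ hW
    have := exists_inner_ge_of_winding (k := k + N) (ψ := ψ) (r := r) (W := V - U) hρ hfN
      (by omega) hf hf' hs' (by rwa [hρN]) (by rwa [hsinN]) hε (by rw [hper]; exact hr') hW
    rwa [hper] at this
  have pointwise : ∀ ψ, Real.sin (ψ - f 0) ≠ 0 → Real.sin (ψ - f k) ≠ 0 →
      4 * (r - ε) + 2 * |inner ℝ (U - V) (polarPoint 1 ψ)| ≤ ∑ i ∈ Finset.range N,
        |inner ℝ (polarPoint (ρ (i + 1)) (f (i + 1)) - polarPoint (ρ i) (f i))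
          (polarPoint 1 ψ)| := by
    intro ψ h0 hk
    have h0' : Real.sin (ψ + Real.pi - f 0) ≠ 0 := by
      rw [show ψ + Real.pi - f 0 = ψ - f 0 + Real.pi by ring, Real.sin_add_pi]
      exact neg_ne_zero.2 h0
    have hk' : Real.sin (ψ + Real.pi - f k) ≠ 0 := by
      rw [show ψ + Real.pi - f k = ψ - f k + Real.pi by ring, Real.sin_add_pi]
      exact neg_ne_zero.2 hk
    have hosc := two_mul_sub_le_sum_abs_sub
      (x := fun i => inner ℝ (polarPoint (ρ i) (f i)) (polarPoint 1 ψ)) hN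
      (fun i => by rw [hper, hρN])
    simp only [← inner_sub_left] at hosc
    have hUV : inner ℝ (V - U) (polarPoint 1 ψ) = -inner ℝ (U - V) (polarPoint 1 ψ) := by
      rw [← inner_neg_left, neg_sub]
    rcases le_total 0 (inner ℝ (U - V) (polarPoint 1 ψ)) with h | h
    · obtain ⟨i, hi⟩ := reachU ψ h0 h
      obtain ⟨j, hj⟩ := reachV (ψ + Real.pi) hk'
        (by rw [polarPoint_add_pi, inner_neg_right, hUV]; linarith)
      rw [polarPoint_add_pi, inner_neg_right, inner_neg_right] at hj
      have := hosc i j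
      rw [abs_of_nonneg h]
      simp only [inner_sub_left] at this ⊢
      linarith
    · obtain ⟨i, hi⟩ := reachV ψ hk (by rw [hUV]; linarith)
      obtain ⟨j, hj⟩ := reachU (ψ + Real.pi) h0'
        (by rw [polarPoint_add_pi, inner_neg_right]; linarith)
      rw [polarPoint_add_pi, inner_neg_right, inner_neg_right] at hj
      have := hosc i j
      rw [abs_of_nonpos h]
      simp only [inner_sub_left] at this ⊢
      linarith
  have hint : ∫ ψ in (0:ℝ)..Real.pi,
      (4 * (r - ε) + 2 * |inner ℝ (U - V) (polarPoint 1 ψ)|) ≤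
      ∫ ψ in (0:ℝ)..Real.pi, ∑ i ∈ Finset.range N,
        |inner ℝ (polarPoint (ρ (i + 1)) (f (i + 1)) - polarPoint (ρ i) (f i))
          (polarPoint 1 ψ)| := by
    refine intervalIntegral.integral_mono_ae Real.pi_pos.le ?_ ?_ ?_
    · exact (continuous_const.add (continuous_const.mul
        (continuous_abs_inner_polarPoint _))).intervalIntegrable _ _
    · exact (continuous_finsetSum _ fun i _ =>
        continuous_abs_inner_polarPoint _).intervalIntegrable _ _
    · filter_upwards [ae_sin_sub_ne_zero (f 0), ae_sin_sub_ne_zero (f k)] with ψ h0 hk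
      exact pointwise ψ h0 hk
  rw [intervalIntegral.integral_finsetSum fun i _ =>
      (continuous_abs_inner_polarPoint _).intervalIntegrable _ _,
    intervalIntegral.integral_add intervalIntegrable_const
      (((continuous_abs_inner_polarPoint _).intervalIntegrable _ _).const_mul _),
    intervalIntegral.integral_const, intervalIntegral.integral_const_mul] at hint
  simp only [integral_abs_inner_polarPoint, ← Finset.mul_sum, smul_eq_mul, sub_zero] at hint
  linarith

section Cone

variable {V : Type*} [NormedAddCommGroup V] [InnerProductSpace ℝ V]

/-- The total angle, seen from the origin, of the polygonal line through `a 0, …, a i`. -/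
noncomputable def sweptAngle (a : ℕ → V) (i : ℕ) : ℝ :=
  ∑ j ∈ Finset.range i, InnerProductGeometry.angle (a j) (a (j + 1))

lemma sweptAngle_zero (a : ℕ → V) : sweptAngle a 0 = 0 := by simp [sweptAngle]

lemma sweptAngle_succ (a : ℕ → V) (i : ℕ) :
    sweptAngle a (i + 1) = sweptAngle a i + InnerProductGeometry.angle (a i) (a (i + 1)) := by
  simp [sweptAngle, Finset.sum_range_succ]

lemma sweptAngle_monotone (a : ℕ → V) : Monotone (sweptAngle a) :=
  monotone_nat_of_le_succ fun i => by
    rw [sweptAngle_succ]; linarith [InnerProductGeometry.angle_nonneg (a i) (a (i + 1))]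

lemma sweptAngle_shift (a : ℕ → V) (k i : ℕ) :
    sweptAngle (fun j => a (j + k)) i = sweptAngle a (i + k) - sweptAngle a k := by
  induction i with
  | zero => simp [sweptAngle_zero]
  | succ n ih =>
    rw [sweptAngle_succ, ih, show n + 1 + k = n + k + 1 by ring, sweptAngle_succ a (n + k)]
    ring

lemma sweptAngle_add_period {a : ℕ → V} {N : ℕ} (ha : ∀ i, a (i + N) = a i) (i : ℕ) :
    sweptAngle a (i + N) = sweptAngle a i + sweptAngle a N := by
  have h := sweptAngle_shift a N i
  simp only [ha] at h
  linarith [show sweptAngle a i = sweptAngle (fun j => a j) i from rfl]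

lemma angle_le_sweptAngle_sub (a : ℕ → V) {i j : ℕ} (hij : i < j) :
    InnerProductGeometry.angle (a i) (a j) ≤ sweptAngle a j - sweptAngle a i := by
  induction j, hij using Nat.le_induction with
  | base => rw [sweptAngle_succ]; linarith
  | succ n _ ih =>
    rw [sweptAngle_succ]
    linarith [InnerProductGeometry.angle_le_angle_add_angle (a i) (a n) (a (n + 1))]

lemma norm_mul_norm_mul_cos_le_inner (a : ℕ → V) {i j : ℕ} (hij : i ≤ j)
    (hπ : sweptAngle a j - sweptAngle a i ≤ Real.pi) :
    ‖a i‖ * ‖a j‖ * Real.cos (sweptAngle a j - sweptAngle a i) ≤ inner ℝ (a i) (a j) := by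
  rcases eq_or_lt_of_le hij with rfl | h
  · rw [sub_self, Real.cos_zero, mul_one, real_inner_self_eq_norm_mul_norm]
  · rw [← InnerProductGeometry.cos_angle_mul_norm_mul_norm, mul_comm]
    exact mul_le_mul_of_nonneg_right (Real.cos_le_cos_of_nonneg_of_le_pi
      (InnerProductGeometry.angle_nonneg _ _) hπ (angle_le_sweptAngle_sub a h)) (by positivity)

lemma neg_norm_mul_norm_le_inner (x y : V) : ‖x‖ * ‖y‖ * (-1) ≤ inner ℝ x y := by
  linarith [neg_abs_le (inner ℝ x y), abs_real_inner_le_norm x y]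

lemma norm_sub_smul_le_norm_sub_polarPoint {x z : V} {y θ φ : ℝ} (hy : 0 ≤ y)
    (h : y * ‖z‖ = 0 ∨ ‖x‖ * ‖z‖ * Real.cos (θ - φ) ≤ inner ℝ x z) :
    ‖x - y • z‖ ≤ ‖polarPoint ‖x‖ θ - polarPoint (y * ‖z‖) φ‖ := by
  have h' : ‖x‖ * (y * ‖z‖) * Real.cos (θ - φ) ≤ y * inner ℝ x z := by
    rcases h with h | h
    · rw [h]
      rcases mul_eq_zero.1 h with h | h
      · simp [h]
      · simp [norm_eq_zero.1 h]
    · linarith [mul_le_mul_of_nonneg_left h hy]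
  refine (pow_le_pow_iff_left₀ (norm_nonneg _) (norm_nonneg _) two_ne_zero).1 ?_
  rw [norm_sub_polarPoint_sq (norm_nonneg _) (by positivity), norm_sub_sq_real,
    real_inner_smul_right, norm_smul, Real.norm_of_nonneg hy]
  linarith

/-- The two-point inequality for a closed polygon whose cone is mapped to the plane by a
contraction `φ` of the angular coordinate. -/
lemma two_point_inequality_of_angular_contraction {a : ℕ → V} {N k : ℕ} {y y' r ε : ℝ}
    (hN : 0 < N) (hk : k < N) (ha : ∀ i, a (i + N) = a i) {φ : ℝ → ℝ}
    (hmono : ∀ x z, x ≤ z → φ x ≤ φ z) (hlip : ∀ x z, x ≤ z → φ z ≤ φ x + (z - x))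
    (hφ0 : φ 0 = 0) (hφN : φ (sweptAngle a N) = 2 * Real.pi)
    (hy : y ∈ Set.Icc (0:ℝ) 1) (hy' : y' ∈ Set.Icc (0:ℝ) 1)
    (hε : ∀ i, ‖a (i + 1) - a i‖ ≤ ε)
    (hr : ∀ i, r ≤ ‖a i - y • a 0‖) (hr' : ∀ i, r ≤ ‖a i - y' • a k‖)
    (hcmp : ∀ i < N, y * ‖a 0‖ ≠ 0 →
      y * ‖a 0‖ * (y * ‖a 0‖ - y' * ‖a k‖ * Real.cos (φ (sweptAngle a k))) ≤
        ‖a i‖ * (y * ‖a 0‖ * Real.cos (φ (sweptAngle a i)) -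
          y' * ‖a k‖ * Real.cos (φ (sweptAngle a i) - φ (sweptAngle a k))) →
      ‖a i‖ * ‖a 0‖ * Real.cos (φ (sweptAngle a i)) ≤ inner ℝ (a i) (a 0))
    (hcmp' : ∀ i < N, y' * ‖a k‖ ≠ 0 →
      y' * ‖a k‖ * (y' * ‖a k‖ - y * ‖a 0‖ * Real.cos (φ (sweptAngle a k))) ≤
        ‖a i‖ * (y' * ‖a k‖ * Real.cos (φ (sweptAngle a i) - φ (sweptAngle a k)) -
          y * ‖a 0‖ * Real.cos (φ (sweptAngle a i))) →
      ‖a i‖ * ‖a k‖ * Real.cos (φ (sweptAngle a i) - φ (sweptAngle a k)) ≤ inner ℝ (a i) (a k))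
    (hdist : ‖a 0‖ * ‖a k‖ * Real.cos (φ (sweptAngle a k)) ≤ inner ℝ (a 0) (a k)) :
    2 * Real.pi * (r - ε) + 2 * ‖y • a 0 - y' • a k‖ ≤
      ∑ i ∈ Finset.range N, ‖a (i + 1) - a i‖ := by
  set f : ℕ → ℝ := fun i => φ (sweptAngle a (i % N)) + (i / N : ℕ) * (2 * Real.pi) with hf
  have hamod : ∀ i, a (i % N) = a i := fun i => (Function.Periodic.map_mod_nat ha i)
  have hf0 : f 0 = 0 := by simp [hf, sweptAngle_zero, hφ0]
  have hfk : f k = φ (sweptAngle a k) := by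
    simp [hf, Nat.mod_eq_of_lt hk, Nat.div_eq_of_lt hk]
  have hfsucc : ∀ i, f (i + 1) =
      φ (sweptAngle a (i % N + 1)) + (i / N : ℕ) * (2 * Real.pi) := by
    intro i
    have hlt := Nat.mod_lt i hN
    have hdiv := Nat.div_add_mod i N
    rcases Nat.lt_or_ge (i % N + 1) N with h | h
    · have h1 : (i + 1) % N = i % N + 1 := by
        rw [Nat.add_mod_eq_add_mod_right 1 (Nat.mod_mod i N).symm, Nat.mod_eq_of_lt h]
      have h2 : (i + 1) / N = i / N := by
        rw [← hdiv, add_assoc, Nat.mul_add_div hN, Nat.div_eq_of_lt h, Nat.mul_add_div hN,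
          Nat.div_eq_of_lt hlt]
      simp only [hf, h1, h2]
    · have h0 : i % N + 1 = N := by omega
      have h1 : (i + 1) % N = 0 := by
        rw [Nat.add_mod_eq_add_mod_right 1 (Nat.mod_mod i N).symm, h0, Nat.mod_self]
      have h2 : (i + 1) / N = i / N + 1 := by
        conv_lhs => rw [← hdiv, add_assoc, h0, Nat.mul_add_div hN, Nat.div_self hN]
      simp only [hf, h1, h2, h0, sweptAngle_zero, hφ0, hφN]
      push_cast
      ring
  have hstep : ∀ i, f i ≤ f (i + 1) ∧
      f (i + 1) ≤ f i + InnerProductGeometry.angle (a i) (a (i + 1)) := by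
    intro i
    have hle := sweptAngle_monotone a (Nat.le_succ (i % N))
    have e := sweptAngle_succ a (i % N)
    have e1 : a (i % N + 1) = a (i + 1) := by
      rw [← hamod (i % N + 1), ← hamod (i + 1)]
      congr 1
      simp
    rw [hamod, e1] at e
    rw [hfsucc]
    have h1 := hmono _ _ hle
    have h2 := hlip _ _ hle
    simp only [hf, Nat.succ_eq_add_one] at h1 h2 ⊢
    constructor <;> linarith
  have hpol : ∀ i, polarPoint ‖a i‖ (f i) =
      polarPoint ‖a (i % N)‖ (φ (sweptAngle a (i % N))) := by
    intro i
    rw [hamod]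
    simpa only [Int.cast_natCast] using
      polarPoint_add_two_pi_mul ‖a i‖ (φ (sweptAngle a (i % N))) ((i / N : ℕ) : ℤ)
  have hedge : ∀ i, ‖polarPoint ‖a (i + 1)‖ (f (i + 1)) - polarPoint ‖a i‖ (f i)‖ ≤
      ‖a (i + 1) - a i‖ := by
    intro i
    refine (pow_le_pow_iff_left₀ (norm_nonneg _) (norm_nonneg _) two_ne_zero).1 ?_
    rw [norm_sub_polarPoint_sq (norm_nonneg _) (norm_nonneg _), norm_sub_sq_real]
    obtain ⟨h1, h2⟩ := hstep i
    have hcos := Real.cos_le_cos_of_nonneg_of_le_pi (x := f (i + 1) - f i) (by linarith)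
      (InnerProductGeometry.angle_le_pi (a i) (a (i + 1))) (by linarith)
    have := InnerProductGeometry.cos_angle_mul_norm_mul_norm (a i) (a (i + 1))
    rw [real_inner_comm] at this
    have := mul_le_mul_of_nonneg_right hcos
      (mul_nonneg (norm_nonneg (a i)) (norm_nonneg (a (i + 1))))
    linarith
  have hy0 := hy.1
  have hy0' := hy'.1
  have hplanar := planar_two_point_inequality (ρ := fun i => ‖a i‖) (f := f) (N := N) (k := k)
    (s := y * ‖a 0‖) (s' := y' * ‖a k‖) (r := r) (ε := ε) hN (fun i => norm_nonneg _)
    (fun i => by rw [ha])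
    (fun i => by simp [hf, Nat.add_div_right i hN]; ring)
    (fun i => (hstep i).1)
    (fun i => (hstep i).2.trans (by linarith [InnerProductGeometry.angle_le_pi (a i) (a (i + 1))]))
    (by positivity) (mul_le_of_le_one_left (norm_nonneg _) hy.2)
    (by positivity) (mul_le_of_le_one_left (norm_nonneg _) hy'.2)
    (fun i => (hedge i).trans (hε i))
    (fun i hi => by
      rw [hpol] at hi ⊢
      refine (hr (i % N)).trans (norm_sub_smul_le_norm_sub_polarPoint hy0 ?_)
      rw [or_iff_not_imp_left]
      intro hne
      rw [hf0, sub_zero]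
      refine hcmp _ (Nat.mod_lt i hN) hne ?_
      simp only [inner_sub_left, inner_sub_right, inner_polarPoint, hf0, hfk, sub_self, sub_zero,
        zero_sub, Real.cos_zero, Real.cos_neg] at hi
      linarith)
    (fun i hi => by
      rw [hpol] at hi ⊢
      refine (hr' (i % N)).trans (norm_sub_smul_le_norm_sub_polarPoint hy0' ?_)
      rw [or_iff_not_imp_left]
      intro hne
      rw [hfk]
      refine hcmp' _ (Nat.mod_lt i hN) hne ?_
      simp only [inner_sub_left, inner_sub_right, inner_polarPoint, hf0, hfk, sub_self, sub_zero,
        Real.cos_zero] at hi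
      linarith)
  have hUV : ‖y • a 0 - y' • a k‖ ≤
      ‖polarPoint (y * ‖a 0‖) (f 0) - polarPoint (y' * ‖a k‖) (f k)‖ := by
    have hnorm : ‖y • a 0‖ = y * ‖a 0‖ := by rw [norm_smul, Real.norm_of_nonneg hy0]
    rw [← hnorm]
    refine norm_sub_smul_le_norm_sub_polarPoint hy0' (Or.inr ?_)
    rw [hf0, hfk, zero_sub, Real.cos_neg, real_inner_smul_left, hnorm]
    linarith [mul_le_mul_of_nonneg_left hdist hy0]
  have hsum := Finset.sum_le_sum fun i (_ : i ∈ Finset.range N) => hedge i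
  linarith

end Cone

lemma sin_mul_sinusoid (s s' α b c x : ℝ) :
    Real.sin (c - b) * (s * Real.cos x - s' * Real.cos (x - α)) =
      Real.sin (c - x) * (s * Real.cos b - s' * Real.cos (b - α)) +
      Real.sin (x - b) * (s * Real.cos c - s' * Real.cos (c - α)) := by
  have key : ∀ u v w : ℝ, Real.sin (v - u) * Real.cos w =
      Real.sin (v - w) * Real.cos u + Real.sin (w - u) * Real.cos v := by
    intro u v w
    simp only [Real.sin_sub]
    ring
  have h1 := key b c x
  have h2 := key (b - α) (c - α) (x - α)
  rw [sub_sub_sub_cancel_right, sub_sub_sub_cancel_right, sub_sub_sub_cancel_right] at h2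
  linear_combination s * h1 - s' * h2

/-- The direction in which a cone containing the triangle with vertices at the origin and at
`polarPoint s 0`, `polarPoint s' α` can be cut open without meeting the two half-planes bounded
by the perpendiculars to the third side at its end points. -/
lemma exists_cut_angle {s s' α : ℝ} (hs : 0 ≤ s) (hs' : 0 ≤ s') (hα0 : 0 ≤ α) (hα : α < Real.pi) :
    ∃ κ, Real.pi ≤ κ ∧ κ ≤ Real.pi + α ∧
      (∀ x, Real.pi < x → x ≤ κ → s ≠ 0 →
        s * Real.cos x - s' * Real.cos (x - α) ≤ 0 ∧ 0 < s - s' * Real.cos α) ∧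
      (∀ x, κ ≤ x → x < Real.pi + α → s' ≠ 0 →
        0 ≤ s * Real.cos x - s' * Real.cos (x - α) ∧ 0 < s' - s * Real.cos α) := by
  have hsin : ∀ {b c : ℝ}, b ≤ c → c ≤ b + Real.pi → 0 ≤ Real.sin (c - b) := fun h1 h2 =>
    Real.sin_nonneg_of_nonneg_of_le_pi (by linarith) (by linarith)
  have hsinpos : ∀ {b c : ℝ}, b < c → c < b + Real.pi → 0 < Real.sin (c - b) := fun h1 h2 =>
    Real.sin_pos_of_pos_of_lt_pi (by linarith) (by linarith)
  have hG1 : s * Real.cos Real.pi - s' * Real.cos (Real.pi - α) = -(s - s' * Real.cos α) := by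
    rw [Real.cos_pi, Real.cos_pi_sub]; ring
  have hG2 : s * Real.cos (Real.pi + α) - s' * Real.cos (Real.pi + α - α) =
      s' - s * Real.cos α := by
    rw [add_sub_cancel_right, Real.cos_pi, add_comm, Real.cos_add_pi]; ring
  have hcosle := Real.cos_le_one α
  have hcos1 : 0 < α → Real.cos α < 1 := fun h => by
    rw [← Real.cos_zero]
    exact Real.cos_lt_cos_of_nonneg_of_le_pi le_rfl hα.le h
  rcases le_or_gt (s - s' * Real.cos α) 0 with h1 | h1
  · refine ⟨Real.pi, le_rfl, by linarith, fun x h h' => by linarith, fun x h h' hne => ?_⟩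
    have hspos : 0 < s' := lt_of_le_of_ne hs' (Ne.symm hne)
    have hαpos : 0 < α := by linarith
    have hpos : 0 < s' - s * Real.cos α := by
      rcases le_or_gt (Real.cos α) 0 with hc | hc
      · nlinarith [mul_nonneg hs (neg_nonneg.2 hc)]
      · have := hcos1 hαpos
        nlinarith [mul_pos hspos hc]
    refine ⟨?_, hpos⟩
    have key := sin_mul_sinusoid s s' α Real.pi (Real.pi + α) x
    rw [hG1, hG2] at key
    have hp := hsinpos (b := Real.pi) (c := Real.pi + α) (by linarith) (by linarith)
    refine nonneg_of_mul_nonneg_right ?_ hp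
    rw [key]
    exact add_nonneg (mul_nonneg (hsin (by linarith) (by linarith)) (by linarith))
      (mul_nonneg (hsin (by linarith) (by linarith)) hpos.le)
  rcases le_or_gt (s' - s * Real.cos α) 0 with h2 | h2
  · refine ⟨Real.pi + α, by linarith, le_rfl, fun x h h' hne => ⟨?_, h1⟩, fun x h h' => by linarith⟩
    have key := sin_mul_sinusoid s s' α Real.pi (Real.pi + α) x
    rw [hG1, hG2] at key
    have hp := hsinpos (b := Real.pi) (c := Real.pi + α) (by linarith) (by linarith)
    refine nonpos_of_mul_nonpos_right ?_ hp
    rw [key]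
    exact add_nonpos
      (mul_nonpos_of_nonneg_of_nonpos (hsin (by linarith) (by linarith)) (by linarith))
      (mul_nonpos_of_nonneg_of_nonpos (hsin (by linarith) (by linarith)) h2)
  · have hcont : ContinuousOn (fun x => s * Real.cos x - s' * Real.cos (x - α))
        (Set.Icc Real.pi (Real.pi + α)) := by fun_prop
    have hivt := intermediate_value_Icc (by linarith) hcont
    obtain ⟨κ, ⟨hκ1, hκ2⟩, hκ⟩ := hivt (show (0:ℝ) ∈ _ by
      simp only [hG1, hG2]
      exact ⟨by linarith, h2.le⟩)
    simp only at hκ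
    refine ⟨κ, hκ1, hκ2, fun x h h' _ => ⟨?_, h1⟩, fun x h h' _ => ⟨?_, h2⟩⟩
    · have key := sin_mul_sinusoid s s' α Real.pi κ x
      rw [hκ, hG1] at key
      refine nonpos_of_mul_nonpos_right ?_
        (hsinpos (b := Real.pi) (c := κ) (by linarith) (by linarith))
      rw [key, mul_zero, add_zero]
      exact mul_nonpos_of_nonneg_of_nonpos (hsin (by linarith) (by linarith)) (by linarith)
    · have key := sin_mul_sinusoid s s' α κ (Real.pi + α) x
      rw [hκ, hG2] at key
      refine nonneg_of_mul_nonneg_right ?_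
        (hsinpos (b := κ) (c := Real.pi + α) (by linarith) (by linarith))
      rw [key, mul_zero, zero_add]
      exact mul_nonneg (hsin (by linarith) (by linarith)) h2.le

/-- A contraction of `[0, Θ]` onto `[0, 2π]` sending `α` to `π`, which is a translation wherever
its value is not `π / 2` or `3π / 2`. -/
lemma exists_contraction_fixing_pi {α Θ : ℝ} (hα : Real.pi ≤ α) (hα' : α + Real.pi ≤ Θ) :
    ∃ φ : ℝ → ℝ, (∀ x z, x ≤ z → φ x ≤ φ z) ∧ (∀ x z, x ≤ z → φ z ≤ φ x + (z - x)) ∧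
      φ 0 = 0 ∧ φ α = Real.pi ∧ φ Θ = 2 * Real.pi ∧
      (∀ x, φ x < Real.pi / 2 → φ x = x) ∧
      (∀ x, Real.pi / 2 < φ x → φ x < 3 * Real.pi / 2 → φ x = x - α + Real.pi) ∧
      (∀ x, 3 * Real.pi / 2 < φ x → φ x = x - Θ + 2 * Real.pi) := by
  have hpi := Real.pi_pos
  refine ⟨fun x => min x (max (Real.pi / 2) (min (x - α + Real.pi)
    (max (3 * Real.pi / 2) (x - Θ + 2 * Real.pi)))), ?_, ?_, ?_, ?_, ?_, ?_, ?_, ?_⟩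
  · intro x z hxz
    simp only
    gcongr
  · intro x z hxz
    have hmin : ∀ {b c b' c' d : ℝ}, b' ≤ b + d → c' ≤ c + d → min b' c' ≤ min b c + d :=
      fun h h' => by rw [← min_add_add_right]; exact min_le_min h h'
    have hmax : ∀ {b c b' c' d : ℝ}, b' ≤ b + d → c' ≤ c + d → max b' c' ≤ max b c + d :=
      fun h h' => by rw [← max_add_add_right]; exact max_le_max h h'
    exact hmin (by linarith) (hmax (by linarith) (hmin (by linarith)
      (hmax (by linarith) (by linarith))))
  · exact min_eq_left (le_max_of_le_left (by linarith))
  · simp only [min_def, max_def]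
    split_ifs <;> linarith
  · simp only [min_def, max_def]
    split_ifs <;> linarith
  · intro x hx
    simp only [min_def, max_def] at hx ⊢
    split_ifs at hx ⊢ <;> linarith
  · intro x hx hx'
    simp only [min_def, max_def] at hx hx' ⊢
    split_ifs at hx hx' ⊢ <;> linarith
  · intro x hx
    simp only [min_def, max_def] at hx ⊢
    split_ifs at hx ⊢ <;> linarith

section Cone

variable {V : Type*} [NormedAddCommGroup V] [InnerProductSpace ℝ V]

lemma two_point_inequality_of_angle_lt_pi {a : ℕ → V} {N k : ℕ} {y y' r ε : ℝ}
    (hN : 0 < N) (hk : k < N) (ha : ∀ i, a (i + N) = a i)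
    (hΘ : 2 * Real.pi ≤ sweptAngle a N) (hα : sweptAngle a k < Real.pi)
    (hy : y ∈ Set.Icc (0:ℝ) 1) (hy' : y' ∈ Set.Icc (0:ℝ) 1)
    (hε : ∀ i, ‖a (i + 1) - a i‖ ≤ ε)
    (hr : ∀ i, r ≤ ‖a i - y • a 0‖) (hr' : ∀ i, r ≤ ‖a i - y' • a k‖) :
    2 * Real.pi * (r - ε) + 2 * ‖y • a 0 - y' • a k‖ ≤
      ∑ i ∈ Finset.range N, ‖a (i + 1) - a i‖ := by
  have hpi := Real.pi_pos
  have hmon := sweptAngle_monotone a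
  have hnonneg : ∀ i, 0 ≤ sweptAngle a i := fun i => by
    rw [← sweptAngle_zero a]; exact hmon (Nat.zero_le i)
  have haN : a N = a 0 := by simpa using ha 0
  have hs : 0 ≤ y * ‖a 0‖ := mul_nonneg hy.1 (norm_nonneg _)
  have hs' : 0 ≤ y' * ‖a k‖ := mul_nonneg hy'.1 (norm_nonneg _)
  obtain ⟨κ, hκ1, hκ2, hu, hv⟩ := exists_cut_angle hs hs' (hnonneg k) hα
  set φ : ℝ → ℝ := fun x => min x (max κ (x - sweptAngle a N + 2 * Real.pi)) with hφ
  have hφk : φ (sweptAngle a k) = sweptAngle a k :=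
    min_eq_left ((by linarith : sweptAngle a k ≤ κ).trans (le_max_left _ _))
  have hcases : ∀ x, (x ≤ κ ∧ φ x = x) ∨ φ x = κ ∨
      (κ ≤ φ x ∧ φ x = x - sweptAngle a N + 2 * Real.pi) := by
    intro x
    simp only [hφ, min_def, max_def]
    split_ifs <;> first
      | exact Or.inl ⟨by linarith, rfl⟩
      | exact Or.inr (Or.inl rfl)
      | exact Or.inr (Or.inr ⟨by linarith, rfl⟩)
      | exact Or.inr (Or.inr ⟨by linarith, by linarith⟩)
  refine two_point_inequality_of_angular_contraction hN hk ha (φ := φ) ?_ ?_ ?_ ?_ hy hy' hε hr hr'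
    ?_ ?_ ?_
  · intro x z hxz
    simp only [hφ]
    gcongr
  · intro x z hxz
    simp only [hφ, min_def, max_def]
    split_ifs <;> linarith
  · simp only [hφ]
    exact min_eq_left (le_max_of_le_left (by linarith))
  · simp only [hφ, min_def, max_def]
    split_ifs <;> linarith
  · intro i hi hne hsec
    have hspos : 0 < y * ‖a 0‖ := lt_of_le_of_ne hs (Ne.symm hne)
    rw [hφk] at hsec
    have hexcl : ∀ x, Real.pi < x → x ≤ κ → φ (sweptAngle a i) ≠ x := by
      intro x h1 h2 h3
      obtain ⟨h4, h5⟩ := hu x h1 h2 hne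
      rw [h3] at hsec
      have := mul_nonpos_of_nonneg_of_nonpos (norm_nonneg (a i)) h4
      have := mul_pos hspos h5
      linarith
    have hsmall : sweptAngle a i ≤ Real.pi →
        ‖a i‖ * ‖a 0‖ * Real.cos (sweptAngle a i) ≤ inner ℝ (a i) (a 0) := by
      intro h
      have := norm_mul_norm_mul_cos_le_inner a (Nat.zero_le i)
        (by rw [sweptAngle_zero, sub_zero]; exact h)
      rw [sweptAngle_zero, sub_zero, real_inner_comm] at this
      linarith
    rcases hcases (sweptAngle a i) with ⟨h1, h2⟩ | h1 | ⟨h1, h2⟩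
    · rcases le_or_gt (sweptAngle a i) Real.pi with h | h
      · rw [h2]; exact hsmall h
      · exact absurd h2 (hexcl _ h h1)
    · rcases eq_or_lt_of_le hκ1 with h | h
      · rw [h1, ← h, Real.cos_pi]; exact neg_norm_mul_norm_le_inner _ _
      · exact absurd h1 (hexcl _ h le_rfl)
    · have := norm_mul_norm_mul_cos_le_inner a hi.le (by linarith)
      rw [haN, ← Real.cos_neg, neg_sub, ← Real.cos_add_two_pi] at this
      rw [h2]
      exact this
  · intro i hi hne hsec
    have hspos : 0 < y' * ‖a k‖ := lt_of_le_of_ne hs' (Ne.symm hne)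
    rw [hφk] at hsec ⊢
    have hexcl : ∀ x, κ ≤ x → x < Real.pi + sweptAngle a k → φ (sweptAngle a i) ≠ x := by
      intro x h1 h2 h3
      obtain ⟨h4, h5⟩ := hv x h1 h2 hne
      rw [h3] at hsec
      have := mul_nonneg (norm_nonneg (a i)) h4
      have := mul_pos hspos h5
      linarith
    rcases hcases (sweptAngle a i) with ⟨h1, h2⟩ | h1 | ⟨h1, h2⟩
    · rw [h2]
      rcases le_total i k with h | h
      · have := norm_mul_norm_mul_cos_le_inner a h (by linarith [hnonneg i])
        rwa [← Real.cos_neg, neg_sub] at this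
      · have := norm_mul_norm_mul_cos_le_inner a h (by linarith)
        rw [real_inner_comm] at this
        linarith
    · rcases eq_or_lt_of_le hκ2 with h | h
      · rw [h1, h, add_sub_cancel_right, Real.cos_pi]; exact neg_norm_mul_norm_le_inner _ _
      · exact absurd h1 (hexcl _ le_rfl h)
    · rcases lt_or_ge (φ (sweptAngle a i)) (Real.pi + sweptAngle a k) with h | h
      · exact absurd rfl (hexcl _ h1 h)
      · have hper := sweptAngle_add_period ha k
        have := norm_mul_norm_mul_cos_le_inner a (show i ≤ k + N by omega) (by linarith)
        rw [ha, ← Real.cos_neg, neg_sub, ← Real.cos_add_two_pi, hper] at this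
        rw [h2]
        convert this using 3
        ring
  · rw [hφk]
    have := norm_mul_norm_mul_cos_le_inner a (Nat.zero_le k)
      (by rw [sweptAngle_zero, sub_zero]; exact hα.le)
    rwa [sweptAngle_zero, sub_zero] at this

lemma two_point_inequality_of_pi_le_angle {a : ℕ → V} {N k : ℕ} {y y' r ε : ℝ}
    (hN : 0 < N) (hk : k < N) (ha : ∀ i, a (i + N) = a i)
    (hα : Real.pi ≤ sweptAngle a k) (hα' : sweptAngle a k + Real.pi ≤ sweptAngle a N)
    (hy : y ∈ Set.Icc (0:ℝ) 1) (hy' : y' ∈ Set.Icc (0:ℝ) 1)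
    (hε : ∀ i, ‖a (i + 1) - a i‖ ≤ ε)
    (hr : ∀ i, r ≤ ‖a i - y • a 0‖) (hr' : ∀ i, r ≤ ‖a i - y' • a k‖) :
    2 * Real.pi * (r - ε) + 2 * ‖y • a 0 - y' • a k‖ ≤
      ∑ i ∈ Finset.range N, ‖a (i + 1) - a i‖ := by
  have hpi := Real.pi_pos
  have hmon := sweptAngle_monotone a
  have hnonneg : ∀ i, 0 ≤ sweptAngle a i := fun i => by
    rw [← sweptAngle_zero a]; exact hmon (Nat.zero_le i)
  have haN : a N = a 0 := by simpa using ha 0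
  have hs : 0 ≤ y * ‖a 0‖ := mul_nonneg hy.1 (norm_nonneg _)
  have hs' : 0 ≤ y' * ‖a k‖ := mul_nonneg hy'.1 (norm_nonneg _)
  obtain ⟨φ, hφmono, hφlip, hφ0, hφk, hφN, hφnear, hφmid, hφfar⟩ :=
    exists_contraction_fixing_pi hα hα'
  have hφnonneg : ∀ i, 0 ≤ φ (sweptAngle a i) := fun i => by
    rw [← hφ0]; exact hφmono _ _ (hnonneg i)
  have hφle : ∀ i < N, φ (sweptAngle a i) ≤ 2 * Real.pi := fun i hi => by
    rw [← hφN]; exact hφmono _ _ (hmon hi.le)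
  refine two_point_inequality_of_angular_contraction hN hk ha hφmono hφlip hφ0 hφN hy hy'
    hε hr hr' ?_ ?_ ?_
  · intro i hi hne hsec
    have hspos : 0 < y * ‖a 0‖ := lt_of_le_of_ne hs (Ne.symm hne)
    rw [hφk, Real.cos_pi, Real.cos_sub_pi] at hsec
    have hcos : 0 < Real.cos (φ (sweptAngle a i)) := by
      by_contra hcon
      push Not at hcon
      have h1 : 0 < y * ‖a 0‖ * (y * ‖a 0‖ + y' * ‖a k‖) := by positivity
      have h2 := mul_nonpos_of_nonneg_of_nonpos
        (mul_nonneg (norm_nonneg (a i)) (add_nonneg hs hs')) hcon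
      linarith
    have hrange : φ (sweptAngle a i) < Real.pi / 2 ∨ 3 * Real.pi / 2 < φ (sweptAngle a i) := by
      by_contra hcon
      push Not at hcon
      have := Real.cos_nonpos_of_pi_div_two_le_of_le hcon.1 (by linarith)
      linarith
    rcases hrange with h | h
    · have h2 := hφnear _ h
      have := norm_mul_norm_mul_cos_le_inner a (Nat.zero_le i)
        (by rw [sweptAngle_zero, sub_zero]; linarith)
      rw [sweptAngle_zero, sub_zero, real_inner_comm] at this
      rw [h2]
      linarith
    · have h2 := hφfar _ h
      have := norm_mul_norm_mul_cos_le_inner a hi.le (by linarith)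
      rw [haN, ← Real.cos_neg, neg_sub, ← Real.cos_add_two_pi] at this
      rw [h2]
      exact this
  · intro i hi hne hsec
    have hspos : 0 < y' * ‖a k‖ := lt_of_le_of_ne hs' (Ne.symm hne)
    rw [hφk, Real.cos_pi, Real.cos_sub_pi] at hsec
    have hcos : Real.cos (φ (sweptAngle a i)) < 0 := by
      by_contra hcon
      push Not at hcon
      have h1 : 0 < y' * ‖a k‖ * (y' * ‖a k‖ + y * ‖a 0‖) := by positivity
      have h2 := mul_nonneg (mul_nonneg (norm_nonneg (a i)) (add_nonneg hs hs')) hcon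
      linarith
    have hlow : Real.pi / 2 < φ (sweptAngle a i) := by
      by_contra hcon
      push Not at hcon
      have := Real.cos_nonneg_of_mem_Icc ⟨by linarith [hφnonneg i], hcon⟩
      linarith
    have hhigh : φ (sweptAngle a i) < 3 * Real.pi / 2 := by
      by_contra hcon
      push Not at hcon
      have := Real.cos_nonneg_of_mem_Icc (x := φ (sweptAngle a i) - 2 * Real.pi)
        ⟨by linarith, by linarith [hφle i hi]⟩
      rw [Real.cos_sub_two_pi] at this
      linarith
    have h2 := hφmid _ hlow hhigh
    rw [hφk, h2, add_sub_cancel_right]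
    rcases le_total i k with h | h
    · have := norm_mul_norm_mul_cos_le_inner a h (by linarith)
      rwa [← Real.cos_neg, neg_sub] at this
    · have := norm_mul_norm_mul_cos_le_inner a h (by linarith)
      rw [real_inner_comm] at this
      linarith
  · rw [hφk, Real.cos_pi]
    exact neg_norm_mul_norm_le_inner _ _

/-- The two-point inequality for a closed polygon whose cone angle at the origin is at least
`2π`. -/
lemma polygon_two_point_inequality {a : ℕ → V} {N k : ℕ} {y y' r ε : ℝ}
    (hN : 0 < N) (hk : k < N) (ha : ∀ i, a (i + N) = a i)
    (hΘ : 2 * Real.pi ≤ sweptAngle a N)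
    (hy : y ∈ Set.Icc (0:ℝ) 1) (hy' : y' ∈ Set.Icc (0:ℝ) 1)
    (hε : ∀ i, ‖a (i + 1) - a i‖ ≤ ε)
    (hr : ∀ i, r ≤ ‖a i - y • a 0‖) (hr' : ∀ i, r ≤ ‖a i - y' • a k‖) :
    2 * Real.pi * (r - ε) + 2 * ‖y • a 0 - y' • a k‖ ≤
      ∑ i ∈ Finset.range N, ‖a (i + 1) - a i‖ := by
  have hpi := Real.pi_pos
  rcases lt_or_ge (sweptAngle a k) Real.pi with hα | hα
  · exact two_point_inequality_of_angle_lt_pi hN hk ha hΘ hα hy hy' hε hr hr'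
  rcases le_or_gt (sweptAngle a k + Real.pi) (sweptAngle a N) with hα' | hα'
  · exact two_point_inequality_of_pi_le_angle hN hk ha hα hα' hy hy' hε hr hr'
  have hk0 : 0 < k := by
    rcases Nat.eq_zero_or_pos k with h | h
    · rw [h, sweptAngle_zero] at hα; linarith
    · exact h
  have haN : a N = a 0 := by simpa using ha 0
  have hNk : N - k + k = N := Nat.sub_add_cancel hk.le
  have key := two_point_inequality_of_angle_lt_pi (a := fun i => a (i + k)) (N := N) (k := N - k)
    (y := y') (y' := y) (r := r) (ε := ε) hN (by omega)
    (fun i => by rw [show i + N + k = i + k + N by ring, ha])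
    (by
      rw [sweptAngle_shift, add_comm N k, sweptAngle_add_period ha]
      linarith)
    (by rw [sweptAngle_shift, hNk]; linarith) hy' hy
    (fun i => by rw [show i + 1 + k = i + k + 1 by ring]; exact hε _)
    (fun i => by simpa using hr' (i + k))
    (fun i => by simp only [hNk, haN]; exact hr (i + k))
  simp only [hNk, haN, zero_add] at key
  rw [norm_sub_rev] at key
  refine key.trans (le_of_eq ?_)
  rw [← sum_range_periodic_shift (F := fun i => ‖a (i + 1) - a i‖) (N := N)
    (fun l => by rw [show l + N + 1 = l + 1 + N by ring, ha, ha]) k]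
  exact Finset.sum_congr rfl fun i _ => by rw [show i + 1 + k = i + k + 1 by ring]

/-- Every angle up to `angle x z < π` is attained by a vector of the segment from `x` to `z`. -/
lemma exists_angle_eq_of_le_angle {x z : V} {τ : ℝ} (hx : x ≠ 0) (hz : z ≠ 0)
    (hπ : InnerProductGeometry.angle x z < Real.pi) (hτ0 : 0 ≤ τ)
    (hτ : τ ≤ InnerProductGeometry.angle x z) :
    ∃ w : V, w ≠ 0 ∧ InnerProductGeometry.angle x w = τ ∧
      InnerProductGeometry.angle w z = InnerProductGeometry.angle x z - τ := by
  have hne : ∀ t ∈ Set.Icc (0:ℝ) 1, AffineMap.lineMap x z t ≠ (0 : V) := by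
    intro t ht h0
    have hw : Wbtw ℝ x 0 z := ⟨t, ht, h0⟩
    have := (Sbtw.angle₁₂₃_eq_pi ⟨hw, hx.symm, hz.symm⟩ : EuclideanGeometry.angle x 0 z = Real.pi)
    simp only [EuclideanGeometry.angle, vsub_eq_sub, sub_zero] at this
    linarith
  have hcont : ContinuousOn (fun t : ℝ => InnerProductGeometry.angle x (AffineMap.lineMap x z t))
      (Set.Icc 0 1) := by
    intro t ht
    have h1 : ContinuousAt (fun t : ℝ => ((x, AffineMap.lineMap x z t) : V × V)) t := by
      simp only [AffineMap.lineMap_apply]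
      fun_prop
    exact ((InnerProductGeometry.continuousAt_angle (x := (x, AffineMap.lineMap x z t)) hx
      (hne t ht)).comp (f := fun t : ℝ => ((x, AffineMap.lineMap x z t) : V × V))
      h1).continuousWithinAt
  obtain ⟨t, ht, hteq⟩ := intermediate_value_Icc zero_le_one hcont (show τ ∈ _ by
    simpa [InnerProductGeometry.angle_self hx] using And.intro hτ0 hτ)
  refine ⟨AffineMap.lineMap x z t, hne t ht, hteq, ?_⟩
  have := EuclideanGeometry.angle_add_of_ne_of_ne hx.symm hz.symm
    (⟨t, ht, rfl⟩ : Wbtw ℝ x (AffineMap.lineMap x z t) z)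
  simp only [EuclideanGeometry.angle, vsub_eq_sub, sub_zero] at this
  linarith

lemma inner_pos_of_angle_add_angle_lt_pi {x z w : V} (hx : x ≠ 0) (hz : z ≠ 0) (hw : w ≠ 0)
    (h : InnerProductGeometry.angle z x + InnerProductGeometry.angle x w < Real.pi) :
    0 < inner ℝ (‖z‖⁻¹ • z + ‖w‖⁻¹ • w) x := by
  have hx' := norm_pos_iff.2 hx
  have hz' := norm_pos_iff.2 hz
  have hw' := norm_pos_iff.2 hw
  have h1 : Real.cos (Real.pi - InnerProductGeometry.angle x w) <
      Real.cos (InnerProductGeometry.angle z x) :=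
    Real.cos_lt_cos_of_nonneg_of_le_pi (InnerProductGeometry.angle_nonneg _ _)
      (by linarith [InnerProductGeometry.angle_nonneg x w]) (by linarith)
  rw [Real.cos_pi_sub] at h1
  rw [inner_add_left, real_inner_smul_left, real_inner_smul_left,
    ← InnerProductGeometry.cos_angle_mul_norm_mul_norm,
    ← InnerProductGeometry.cos_angle_mul_norm_mul_norm, InnerProductGeometry.angle_comm w x]
  have : ‖z‖⁻¹ * (Real.cos (InnerProductGeometry.angle z x) * (‖z‖ * ‖x‖)) +
      ‖w‖⁻¹ * (Real.cos (InnerProductGeometry.angle x w) * (‖w‖ * ‖x‖)) =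
      ‖x‖ * (Real.cos (InnerProductGeometry.angle z x) +
        Real.cos (InnerProductGeometry.angle x w)) := by
    field_simp
  rw [this]
  exact mul_pos hx' (by linarith)

/-- A closed polygon avoiding the origin whose convex hull contains the origin subtends a total
angle of at least `2π`. -/
lemma two_pi_le_sweptAngle {a : ℕ → V} {N : ℕ} (hN : 0 < N) (ha : ∀ i, a (i + N) = a i)
    (hne : ∀ i, a i ≠ 0) (h0 : (0 : V) ∈ convexHull ℝ (a '' Set.Iio N)) :
    2 * Real.pi ≤ sweptAngle a N := by
  by_contra hcon
  push Not at hcon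
  have haN : a N = a 0 := by simpa using ha 0
  have hmon := sweptAngle_monotone a
  have hangle : ∀ {i j}, i ≤ j →
      InnerProductGeometry.angle (a i) (a j) ≤ sweptAngle a j - sweptAngle a i := by
    intro i j hij
    rcases eq_or_lt_of_le hij with rfl | h
    · rw [InnerProductGeometry.angle_self (hne i), sub_self]
    · exact angle_le_sweptAngle_sub a h
  have hΘ : 0 ≤ sweptAngle a N := by
    rw [← sweptAngle_zero a]; exact hmon (Nat.zero_le N)
  obtain ⟨m, hm, hm1, hm2⟩ := exists_sign_change (fun i => sweptAngle a i - sweptAngle a N / 2)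
    (by simp only [sweptAngle_zero]; linarith) hN (by linarith)
  have hδ := sweptAngle_succ a m
  have hδ2 : 2 * InnerProductGeometry.angle (a m) (a (m + 1)) ≤ sweptAngle a N := by
    have h1 := hangle (show m + 1 ≤ m + N by omega)
    rw [ha, sweptAngle_add_period ha, InnerProductGeometry.angle_comm] at h1
    linarith
  obtain ⟨w, hw, hw1, hw2⟩ := exists_angle_eq_of_le_angle (hne m) (hne (m + 1))
    (τ := sweptAngle a N / 2 - sweptAngle a m) (by linarith) (by linarith) (by linarith)
  have hpos : ∀ i < N, 0 < inner ℝ (‖a 0‖⁻¹ • a 0 + ‖w‖⁻¹ • w) (a i) := by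
    intro i hi
    refine inner_pos_of_angle_add_angle_lt_pi (hne i) (hne 0) hw ?_
    rcases le_or_gt i m with h | h
    · have h1 := hangle (Nat.zero_le i)
      have h2 := hangle h
      have h3 := InnerProductGeometry.angle_le_angle_add_angle (a i) (a m) w
      rw [sweptAngle_zero] at h1
      linarith
    · have h1 := hangle hi.le
      have h2 := hangle (Nat.succ_le_of_lt h)
      have h3 := InnerProductGeometry.angle_le_angle_add_angle w (a (m + 1)) (a i)
      rw [haN, InnerProductGeometry.angle_comm] at h1
      rw [InnerProductGeometry.angle_comm w (a i)] at h3
      rw [Nat.succ_eq_add_one] at h2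
      linarith
  have hconv : Convex ℝ {x : V | 0 < inner ℝ (‖a 0‖⁻¹ • a 0 + ‖w‖⁻¹ • w) x} :=
    convex_halfSpace_gt (innerₗ V (‖a 0‖⁻¹ • a 0 + ‖w‖⁻¹ • w)).isLinear 0
  have := convexHull_min (by rintro _ ⟨i, hi, rfl⟩; exact hpos i hi) hconv h0
  simp at this

/-- If every vertex of a closed polygon is repeated at least five times and the convex hull of the
vertices contains the origin, then the polygon subtends a total angle of at least `2π`. -/
lemma two_pi_le_sweptAngle_div_five {c : ℕ → V} {N : ℕ} (hN : 0 < N) (hc : ∀ i, c (i + N) = c i)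
    (h0 : (0 : V) ∈ convexHull ℝ (c '' Set.Iio N)) :
    2 * Real.pi ≤ sweptAngle (fun i => c (i / 5)) (N * 5) := by
  by_cases hne : ∀ i, c i ≠ 0
  · refine two_pi_le_sweptAngle (by omega) (fun i => ?_) (fun i => hne _) ?_
    · rw [Nat.add_mul_div_right _ _ (by norm_num), hc]
    · refine convexHull_mono ?_ h0
      rintro _ ⟨i, hi, rfl⟩
      refine ⟨i * 5, ?_, by simp⟩
      simp only [Set.mem_Iio] at hi ⊢
      omega
  · push Not at hne
    obtain ⟨i, hi⟩ := hne
    have hmod : ∀ i, c (i % N) = c i := fun i => Function.Periodic.map_mod_nat hc i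
    have hlt := Nat.mod_lt i hN
    rw [← hmod] at hi
    set j := i % N
    have hmon := sweptAngle_monotone fun i => c (i / 5)
    have hstep : ∀ l < 4, sweptAngle (fun i => c (i / 5)) (j * 5 + l + 1) =
        sweptAngle (fun i => c (i / 5)) (j * 5 + l) + Real.pi / 2 := by
      intro l hl
      rw [sweptAngle_succ, show (j * 5 + l) / 5 = j by omega, hi,
        InnerProductGeometry.angle_zero_left]
    have h1 := hmon (Nat.zero_le (j * 5))
    have h2 := hmon (show j * 5 + 4 ≤ N * 5 by omega)
    have h3 := hstep 0 (by norm_num)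
    have h4 := hstep 1 (by norm_num)
    have h5 := hstep 2 (by norm_num)
    have h6 := hstep 3 (by norm_num)
    simp only [sweptAngle_zero, add_zero, add_assoc, Nat.reduceAdd] at h1 h2 h3 h4 h5 h6
    linarith

end Cone

lemma exists_partition_Icc {S : Finset ℝ} {δ : ℝ} (hS : ∀ s ∈ S, s ∈ Set.Icc (0:ℝ) 1)
    (hδ : 0 < δ) :
    ∃ (t : ℕ → ℝ) (N : ℕ), 0 < N ∧ Monotone t ∧ t 0 = 0 ∧ t N = 1 ∧
      (∀ i, t (i + 1) - t i < δ) ∧ ∀ s ∈ S, ∃ i ≤ N, t i = s := by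
  induction S using Finset.induction_on with
  | empty =>
    obtain ⟨n, hn⟩ := exists_nat_gt (1 / δ)
    have hnpos : (0:ℝ) < n := lt_trans (by positivity) hn
    refine ⟨fun i => i / n, n, by exact_mod_cast hnpos, ?_, by simp, div_self hnpos.ne', ?_,
      by simp⟩
    · intro i j hij
      simp only
      gcongr
    · intro i
      rw [← sub_div]
      push_cast
      rw [add_sub_cancel_left, div_lt_comm₀ hnpos hδ]
      exact hn
  | insert s S hs ih =>
    obtain ⟨t, N, hN, hmono, ht0, htN, hstep, hcover⟩ :=
      ih fun s' hs' => hS s' (Finset.mem_insert_of_mem hs')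
    obtain ⟨hs0, hs1⟩ := hS s (Finset.mem_insert_self s S)
    obtain ⟨m, hm, hm1, hm2⟩ := exists_sign_change (fun i => t i - s) (by linarith) hN (by linarith)
    set q : ℕ → ℝ := fun i => if i ≤ m then t i else if i = m + 1 then s else t (i - 1) with hq
    have hqle : ∀ i ≤ m, q i = t i := fun i hi => if_pos hi
    have hqs : q (m + 1) = s := by simp [hq]
    have hqgt : ∀ i, m < i → q (i + 1) = t i := fun i hi => by
      simp [hq, hi.ne', Nat.not_le.2 (Nat.lt_succ_of_lt hi)]
    have hqstep : ∀ i, q i ≤ q (i + 1) ∧ q (i + 1) - q i < δ := by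
      intro i
      rcases lt_trichotomy i m with h | rfl | h
      · rw [hqle i h.le, hqle (i + 1) h]
        exact ⟨hmono (Nat.le_succ i), hstep i⟩
      · rw [hqle i le_rfl, hqs]
        exact ⟨by linarith, by linarith [hstep i]⟩
      · rw [hqgt i h]
        rcases eq_or_lt_of_le (Nat.succ_le_of_lt h) with rfl | h'
        · rw [Nat.succ_eq_add_one, hqs]
          exact ⟨by linarith, by linarith [hstep m]⟩
        · obtain ⟨j, rfl⟩ : ∃ j, i = j + 1 := ⟨i - 1, by omega⟩
          rw [hqgt j (by omega)]
          exact ⟨hmono (Nat.le_succ j), hstep j⟩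
    refine ⟨q, N + 1, by omega, monotone_nat_of_le_succ fun i => (hqstep i).1,
      (hqle 0 (Nat.zero_le m)).trans ht0, (hqgt N hm).trans htN, fun i => (hqstep i).2, ?_⟩
    intro s' hs'
    rcases Finset.mem_insert.1 hs' with rfl | hs'
    · exact ⟨m + 1, by omega, hqs⟩
    · obtain ⟨i, hi, rfl⟩ := hcover s' hs'
      rcases le_or_gt i m with h | h
      · exact ⟨i, by omega, hqle i h⟩
      · exact ⟨i + 1, by omega, hqgt i h⟩

lemma sum_range_mul_five_norm_sub {V : Type*} [SeminormedAddCommGroup V] (d : ℕ → V)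
    (N : ℕ) :
    ∑ i ∈ Finset.range (N * 5), ‖d ((i + 1) / 5) - d (i / 5)‖ =
      ∑ i ∈ Finset.range N, ‖d (i + 1) - d i‖ := by
  induction N with
  | zero => simp
  | succ N ih =>
    rw [show (N + 1) * 5 = N * 5 + 1 + 1 + 1 + 1 + 1 by ring]
    simp only [Finset.sum_range_succ, ih]
    rw [show (N * 5 + 1 + 1 + 1 + 1 + 1) / 5 = N + 1 by omega,
      show (N * 5 + 1 + 1 + 1 + 1) / 5 = N by omega, show (N * 5 + 1 + 1 + 1) / 5 = N by omega,
      show (N * 5 + 1 + 1) / 5 = N by omega, show (N * 5 + 1) / 5 = N by omega,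
      show N * 5 / 5 = N by omega]
    simp

section Cone

variable {V : Type*} [NormedAddCommGroup V] [InnerProductSpace ℝ V]

/-- The two-point inequality for a closed polygon whose convex hull contains the origin. -/
lemma polygon_two_point_inequality_of_mem_convexHull {c : ℕ → V} {N k k' : ℕ} {y y' r ε : ℝ}
    (hN : 0 < N) (hc : ∀ i, c (i + N) = c i) (h0 : (0 : V) ∈ convexHull ℝ (c '' Set.Iio N))
    (hy : y ∈ Set.Icc (0:ℝ) 1) (hy' : y' ∈ Set.Icc (0:ℝ) 1)
    (hε : ∀ i, ‖c (i + 1) - c i‖ ≤ ε)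
    (hr : ∀ i, r ≤ ‖c i - y • c k‖) (hr' : ∀ i, r ≤ ‖c i - y' • c k'‖) :
    2 * Real.pi * (r - ε) + 2 * ‖y • c k - y' • c k'‖ ≤
      ∑ i ∈ Finset.range N, ‖c (i + 1) - c i‖ := by
  set d : ℕ → V := fun i => c (i + k) with hd
  have hdper : ∀ i, d (i + N) = d i := fun i => by
    simp only [hd]; rw [add_right_comm, hc]
  have hcd : ∀ i, ∃ j < N, d j = c i := by
    intro i
    refine ⟨(i + k * (N - 1)) % N, Nat.mod_lt _ hN, ?_⟩
    rw [Function.Periodic.map_mod_nat hdper]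
    obtain ⟨M, rfl⟩ : ∃ M, N = M + 1 := ⟨N - 1, by omega⟩
    simp only [hd, Nat.add_sub_cancel]
    rw [show i + k * M + k = i + k * (M + 1) by ring]
    exact Function.Periodic.nat_mul hc k i
  obtain ⟨l, hl, hlk⟩ := hcd k'
  have hd0 : d 0 = c k := by simp [hd]
  have hε0 : 0 ≤ ε := (norm_nonneg _).trans (hε 0)
  have key := polygon_two_point_inequality (a := fun i => d (i / 5)) (N := N * 5) (k := l * 5)
    (y := y) (y' := y') (r := r) (ε := ε) (by omega) (by omega)
    (fun i => by rw [Nat.add_mul_div_right _ _ (by norm_num), hdper])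
    (two_pi_le_sweptAngle_div_five hN hdper (convexHull_mono (by
      rintro _ ⟨i, -, rfl⟩
      exact hcd i) h0)) hy hy'
    (fun i => by
      rcases (show (i + 1) / 5 = i / 5 ∨ (i + 1) / 5 = i / 5 + 1 by omega) with h | h
      · simpa [h] using hε0
      · simp only [h, hd]
        rw [add_right_comm]
        exact hε _)
    (fun i => by rw [Nat.zero_div, hd0]; exact hr _)
    (fun i => by rw [Nat.mul_div_cancel _ (by norm_num), hlk]; exact hr' _)
  rw [Nat.zero_div, hd0, Nat.mul_div_cancel _ (by norm_num), hlk,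
    sum_range_mul_five_norm_sub] at key
  refine key.trans (le_of_eq ?_)
  rw [← sum_range_periodic_shift (F := fun i => ‖c (i + 1) - c i‖) (N := N)
    (fun i => by rw [add_right_comm, hc, hc]) k]
  exact Finset.sum_congr rfl fun i _ => by simp only [hd]; rw [add_right_comm]

/-- The two-point inequality with an error term coming from polygonal approximation. -/
lemma ofReal_sub_le_eVariationOn {C : ℝ → V} (hC : ContinuousOn C (Set.Icc 0 1))
    (hclosed : C 0 = C 1) {p : V} (hp : p ∈ convexHull ℝ (C '' Set.Icc 0 1)) {r ε x x' y y' : ℝ}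
    (hε : 0 < ε) (hx : x ∈ Set.Icc (0:ℝ) 1) (hx' : x' ∈ Set.Icc (0:ℝ) 1)
    (hy : y ∈ Set.Icc (0:ℝ) 1) (hy' : y' ∈ Set.Icc (0:ℝ) 1)
    (hr : ∀ t ∈ Set.Icc (0:ℝ) 1, r ≤ dist (y • C x + (1 - y) • p) (C t))
    (hr' : ∀ t ∈ Set.Icc (0:ℝ) 1, r ≤ dist (y' • C x' + (1 - y') • p) (C t)) :
    ENNReal.ofReal (2 * Real.pi * (r - ε) +
      2 * dist (y • C x + (1 - y) • p) (y' • C x' + (1 - y') • p)) ≤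
      eVariationOn C (Set.Icc 0 1) := by
  classical
  rw [convexHull_eq_union_convexHull_finite_subsets] at hp
  simp only [Set.mem_iUnion] at hp
  obtain ⟨P, hP, hpP⟩ := hp
  obtain ⟨S, hS, rfl⟩ := Finset.subset_set_image_iff.1 hP
  obtain ⟨δ, hδ, hCδ⟩ := Metric.uniformContinuousOn_iff_le.1
    (isCompact_Icc.uniformContinuousOn_of_continuous hC) ε hε
  obtain ⟨t, N, hN, hmono, ht0, htN, hstep, hcover⟩ :=
    exists_partition_Icc (S := insert x (insert x' S)) (δ := δ) (by
      intro s hs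
      simp only [Finset.mem_insert] at hs
      rcases hs with rfl | rfl | hs
      exacts [hx, hx', hS hs]) hδ
  have htmem : ∀ i ≤ N, t i ∈ Set.Icc (0:ℝ) 1 := fun i hi =>
    ⟨ht0 ▸ hmono (Nat.zero_le i), htN ▸ hmono hi⟩
  set c : ℕ → V := fun i => C (t (i % N)) - p with hcdef
  have hper : ∀ i, c (i + N) = c i := fun i => by simp [hcdef]
  have hcle : ∀ i ≤ N, c i = C (t i) - p := by
    intro i hi
    rcases eq_or_lt_of_le hi with rfl | h
    · simp [hcdef, ht0, htN, hclosed]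
    · simp [hcdef, Nat.mod_eq_of_lt h]
  have hcmod : ∀ i, c (i % N) = c i := Function.Periodic.map_mod_nat hper
  have hcsucc : ∀ i, c (i + 1) - c i = C (t (i % N + 1)) - C (t (i % N)) := by
    intro i
    have hlt := Nat.mod_lt i hN
    have h1 : c (i + 1) = c (i % N + 1) := by
      rw [← hcmod (i + 1), ← hcmod (i % N + 1), Nat.mod_add_mod]
    rw [h1, ← hcmod i, hcle _ hlt, hcle _ hlt.le, sub_sub_sub_cancel_right]
  have hindex : ∀ s ∈ insert x (insert x' S), ∃ i < N, c i = C s - p := by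
    intro s hs
    obtain ⟨i, hi, rfl⟩ := hcover s hs
    exact ⟨i % N, Nat.mod_lt i hN, by rw [hcmod, hcle i hi]⟩
  obtain ⟨k, -, hk⟩ := hindex x (by simp)
  obtain ⟨k', -, hk'⟩ := hindex x' (by simp)
  have hdist : ∀ (i : ℕ) (z : V) (l : ℝ),
      ‖c i - l • (z - p)‖ = dist (l • z + (1 - l) • p) (C (t (i % N))) := by
    intro i z l
    rw [dist_eq_norm']
    congr 1
    module
  have key := polygon_two_point_inequality_of_mem_convexHull (c := c) (k := k) (k' := k')
    (y := y) (y' := y') (r := r) (ε := ε) hN hper ?_ hy hy' ?_ ?_ ?_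
  · rw [hk, hk', show y • (C x - p) - y' • (C x' - p) =
      (y • C x + (1 - y) • p) - (y' • C x' + (1 - y') • p) by module, ← dist_eq_norm] at key
    refine (ENNReal.ofReal_le_ofReal key).trans ?_
    rw [ENNReal.ofReal_sum_of_nonneg fun i _ => norm_nonneg _]
    refine le_trans (le_of_eq ?_) (eVariationOn.sum_le_of_monotoneOn_Iic (n := N)
      (hmono.monotoneOn _) htmem)
    refine Finset.sum_congr rfl fun i hi => ?_
    rw [hcsucc, Nat.mod_eq_of_lt (Finset.mem_range.1 hi), edist_dist, dist_eq_norm]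
  · have hconv := (convex_convexHull ℝ (c '' Set.Iio N)).translate_preimage_right (-p)
    have hsub : (S.image C : Set V) ⊆ (fun z => -p + z) ⁻¹' convexHull ℝ (c '' Set.Iio N) := by
      intro z hz
      obtain ⟨s, hs, rfl⟩ := Finset.mem_image.1 (Finset.mem_coe.1 hz)
      obtain ⟨i, hi, his⟩ := hindex s (by simp [hs])
      refine subset_convexHull ℝ _ ⟨i, hi, ?_⟩
      rw [his, sub_eq_neg_add]
    simpa using convexHull_min hsub hconv hpP
  · intro i
    have hlt := Nat.mod_lt i hN
    rw [hcsucc, ← dist_eq_norm]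
    refine hCδ _ (htmem _ hlt) _ (htmem _ hlt.le) ?_
    rw [Real.dist_eq, abs_of_nonneg (sub_nonneg.2 (hmono (Nat.le_succ _)))]
    exact (hstep _).le
  · intro i
    rw [hk, hdist]
    exact hr _ (htmem _ (Nat.mod_lt i hN).le)
  · intro i
    rw [hk', hdist]
    exact hr' _ (htmem _ (Nat.mod_lt i hN).le)

end Cone

/-- Two-point cone inequality: a closed curve `C` whose `p`-cone contains two points
at distance at least `r` from the curve satisfies `len(C) ≥ 2πr + 2‖u - v‖`. -/
theorem cone_two_point_inequality
    (C : ℝ → EuclideanSpace ℝ (Fin 3))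
    (hC : ContinuousOn C (Set.Icc 0 1)) (hclosed : C 0 = C 1)
    (p : EuclideanSpace ℝ (Fin 3))
    (hp : p ∈ convexHull ℝ (C '' Set.Icc 0 1))
    (r : ℝ) (hr : 0 ≤ r)
    (u v : EuclideanSpace ℝ (Fin 3))
    (hu : u ∈ {z | ∃ x ∈ Set.Icc (0:ℝ) 1, ∃ y ∈ Set.Icc (0:ℝ) 1,
      z = y • C x + (1 - y) • p})
    (hv : v ∈ {z | ∃ x ∈ Set.Icc (0:ℝ) 1, ∃ y ∈ Set.Icc (0:ℝ) 1,
      z = y • C x + (1 - y) • p})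
    (hud : ∀ t ∈ Set.Icc (0:ℝ) 1, r ≤ dist u (C t))
    (hvd : ∀ t ∈ Set.Icc (0:ℝ) 1, r ≤ dist v (C t)) :
    ENNReal.ofReal (2 * Real.pi * r + 2 * dist u v) ≤ eVariationOn C (Set.Icc 0 1) := by
  obtain ⟨x, hx, y, hy, rfl⟩ := hu
  obtain ⟨x', hx', y', hy', rfl⟩ := hv
  set D := dist (y • C x + (1 - y) • p) (y' • C x' + (1 - y') • p)
  have hlim : Filter.Tendsto (fun ε : ℝ => ENNReal.ofReal (2 * Real.pi * (r - ε) + 2 * D))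
      (nhdsWithin 0 (Set.Ioi 0)) (nhds (ENNReal.ofReal (2 * Real.pi * r + 2 * D))) := by
    have hcont : Continuous fun ε : ℝ => ENNReal.ofReal (2 * Real.pi * (r - ε) + 2 * D) :=
      ENNReal.continuous_ofReal.comp (by fun_prop)
    simpa using (hcont.tendsto 0).mono_left nhdsWithin_le_nhds
  refine le_of_tendsto hlim ?_
  filter_upwards [self_mem_nhdsWithin] with ε hε
  exact ofReal_sub_le_eVariationOn hC hclosed hp hε hx hx' hy hy' hud hvd
end
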